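/- arXiv:1905.10526 — 6 statements merged into one kernel-verified Lean document; each statement's English description precedes it below -/
import Mathlib

section
/- For all integers n ≥ 1 and k ≥ 2, the polynomial identity NC_{n+1}^{(k)}(t) = t · Σ_{i=0}^{n} C(n,i) · NW_{i}^{(k)}(t) holds in ℤ[t], where NC_{m}^{(k)}(t) is the sum of t^{(number of blocks of P)} over all k-noncrossing partitions P of {1,…,m}, NW_{m}^{(k)}(t) is the sum of t^{(number of blocks of P)} over all enhanced k-noncrossing partitions P of {1,…,m}, and NW_0^{(k)}(t) = 1 by convention. -/
open Finset Polynomial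

/-- `(i,j)` with `i < j` is an arc of the arc diagram of `P`: `i` and `j` lie in a common
block `B` and no element of `B` is strictly between them. -/
def IsArc {s : Finset ℕ} (P : Finpartition s) (i j : ℕ) : Prop :=
  i < j ∧ ∃ B ∈ P.parts, i ∈ B ∧ j ∈ B ∧ ∀ l ∈ B, ¬(i < l ∧ l < j)

/-- `(i,j)` is an arc or a loop (`i = j` and `{i}` a singleton block) of the arc diagram. -/
def IsDiagArc {s : Finset ℕ} (P : Finpartition s) (i j : ℕ) : Prop :=
  IsArc P i j ∨ (i = j ∧ {i} ∈ P.parts)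

/-- `P` has a `k`-crossing: arcs `(i₁,j₁),…,(i_k,j_k)` with `i₁<⋯<i_k<j₁<⋯<j_k`. -/
def HasKCrossing {s : Finset ℕ} (P : Finpartition s) (k : ℕ) : Prop :=
  ∃ f g : Fin k → ℕ,
    StrictMono f ∧ StrictMono g ∧ (∀ m, IsDiagArc P (f m) (g m)) ∧
    ∀ a b : Fin k, f a < g b

/-- `P` has a weak `k`-crossing: arcs `(i₁,j₁),…,(i_k,j_k)` with
`i₁<⋯<i_k = j₁<⋯<j_k` (the largest left endpoint equals the smallest right endpoint). -/
def HasWeakKCrossing {s : Finset ℕ} (P : Finpartition s) (k : ℕ) : Prop :=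
  ∃ f g : Fin k → ℕ,
    StrictMono f ∧ StrictMono g ∧ (∀ m, IsDiagArc P (f m) (g m)) ∧
    ∃ a b : Fin k, f a = g b ∧ (∀ c, f c ≤ f a) ∧ (∀ c, g b ≤ g c)

/-- `P` has an enhanced `k`-crossing: a `k`-crossing or a weak `k`-crossing. -/
def HasEnhancedKCrossing {s : Finset ℕ} (P : Finpartition s) (k : ℕ) : Prop :=
  HasKCrossing P k ∨ HasWeakKCrossing P k

open scoped Classical in
/-- The generating polynomial `∑ t^{number of blocks}` over the partitions of `s`
satisfying the predicate `pr`. -/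
noncomputable def partPoly (s : Finset ℕ) (pr : Finpartition s → Prop) : Polynomial ℤ :=
  ∑ P : Finpartition s, if pr P then (X : Polynomial ℤ) ^ P.parts.card else 0

open Relation

/-- `A` is the set of arcs of a partition of `s`: every arc goes strictly up inside `s`, and every
element is the left end and the right end of at most one arc. -/
def IsArcSet (s : Finset ℕ) (A : Finset (ℕ × ℕ)) : Prop :=
  (∀ i j, (i, j) ∈ A → i ∈ s ∧ j ∈ s ∧ i < j) ∧
    (∀ i j j', (i, j) ∈ A → (i, j') ∈ A → j = j') ∧
    ∀ i i' j, (i, j) ∈ A → (i', j) ∈ A → i = i'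

open scoped Classical in
/-- The arc sets of partitions of `s`. -/
noncomputable def arcSets (s : Finset ℕ) : Finset (Finset (ℕ × ℕ)) :=
  {A ∈ (s ×ˢ s).powerset | IsArcSet s A}

open scoped Classical in
/-- The set of arcs of the partition `P`. -/
noncomputable def arcs {s : Finset ℕ} (P : Finpartition s) : Finset (ℕ × ℕ) :=
  {p ∈ s ×ˢ s | IsArc P p.1 p.2}

/-- `A` has `k` arcs all of whose left ends are smaller than all of their right ends. -/
def HasStrictCrossing (A : Finset (ℕ × ℕ)) (k : ℕ) : Prop :=
  ∃ f g : Fin k → ℕ, StrictMono f ∧ StrictMono g ∧ (∀ m, (f m, g m) ∈ A) ∧ ∀ a b, f a < g b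

/-- `A` has `k` arcs all of whose left ends are at most all of their right ends. -/
def HasLooseCrossing (A : Finset (ℕ × ℕ)) (k : ℕ) : Prop :=
  ∃ f g : Fin k → ℕ, StrictMono f ∧ StrictMono g ∧ (∀ m, (f m, g m) ∈ A) ∧ ∀ a b, f a ≤ g b

theorem mem_arcSets {s : Finset ℕ} {A : Finset (ℕ × ℕ)} : A ∈ arcSets s ↔ IsArcSet s A := by
  simp only [arcSets, mem_filter, mem_powerset, and_iff_right_iff_imp]
  rintro h ⟨i, j⟩ hp
  have := h.1 i j hp
  simp [this]

section Arcs

variable {s : Finset ℕ} {P : Finpartition s} {i j : ℕ}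

theorem IsArc.mem (h : IsArc P i j) : i ∈ s ∧ j ∈ s := by
  obtain ⟨-, B, hB, hi, hj, -⟩ := h
  exact ⟨P.le hB hi, P.le hB hj⟩

theorem mem_arcs : (i, j) ∈ arcs P ↔ IsArc P i j := by
  simp only [arcs, mem_filter, mem_product, and_iff_right_iff_imp]
  exact IsArc.mem

theorem isArc_iff : IsArc P i j ↔ i < j ∧ j ∈ P.part i ∧ ∀ l ∈ P.part i, ¬(i < l ∧ l < j) := by
  constructor
  · rintro ⟨h, B, hB, hi, hj, hl⟩
    obtain rfl := P.part_eq_of_mem hB hi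
    exact ⟨h, hj, hl⟩
  · rintro ⟨h, hj, hl⟩
    have hi : i ∈ s := by
      rw [← Finpartition.part_nonempty (P := P)]
      exact ⟨j, hj⟩
    exact ⟨h, _, P.part_mem.2 hi, P.mem_part hi, hj, hl⟩

theorem isArcSet_arcs (P : Finpartition s) : IsArcSet s (arcs P) := by
  simp only [IsArcSet, mem_arcs]
  refine ⟨fun i j h => ⟨h.mem.1, h.mem.2, h.1⟩, ?_, ?_⟩
  · rintro i j j' ⟨h, B, hB, hi, hj, hl⟩ ⟨h', B', hB', hi', hj', hl'⟩
    obtain rfl := P.eq_of_mem_parts hB hB' hi hi'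
    have := hl _ hj'
    have := hl' _ hj
    omega
  · rintro i i' j ⟨h, B, hB, hi, hj, hl⟩ ⟨h', B', hB', hi', hj', hl'⟩
    obtain rfl := P.eq_of_mem_parts hB hB' hj hj'
    have := hl _ hi'
    have := hl' _ hi
    omega

theorem reflTransGen_isArc {B : Finset ℕ} (hB : B ∈ P.parts) (hi : i ∈ B) (hj : j ∈ B)
    (hij : i ≤ j) : ReflTransGen (IsArc P) i j := by
  induction j using Nat.strong_induction_on with
  | _ j ih =>
    rcases hij.eq_or_lt with rfl | hlt
    · exact .refl
    have hne : ({l ∈ B | l < j} : Finset ℕ).Nonempty := ⟨i, by simp [hi, hlt]⟩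
    have hm := max'_mem _ hne
    have hmax : ∀ l ∈ ({l ∈ B | l < j} : Finset ℕ), l ≤ ({l ∈ B | l < j} : Finset ℕ).max' hne :=
      fun l hl => le_max' _ l hl
    generalize ({l ∈ B | l < j} : Finset ℕ).max' hne = m at hm hmax
    simp only [mem_filter] at hm hmax
    refine (ih m hm.2 hm.1 (hmax i ⟨hi, hlt⟩)).tail ⟨hm.2, B, hB, hm.1, hj, ?_⟩
    rintro l hl ⟨h1, h2⟩
    have := hmax l ⟨hl, h2⟩
    omega

theorem mem_part_of_reflTransGen_isArc (hi : i ∈ s) (h : ReflTransGen (IsArc P) i j) :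
    j ∈ P.part i := by
  induction h with
  | refl => exact P.mem_part hi
  | tail _ hbc ih =>
    obtain ⟨-, B, hB, hb, hc, -⟩ := hbc
    rwa [P.eq_of_mem_parts (P.part_mem.2 hi) hB ih hb]

theorem mem_part_iff_reflTransGen_isArc (hi : i ∈ s) (hj : j ∈ s) :
    j ∈ P.part i ↔ ReflTransGen (IsArc P) i j ∨ ReflTransGen (IsArc P) j i := by
  constructor
  · intro h
    rcases le_total i j with hij | hij
    · exact .inl (reflTransGen_isArc (P.part_mem.2 hi) (P.mem_part hi) h hij)
    · exact .inr (reflTransGen_isArc (P.part_mem.2 hi) h (P.mem_part hi) hij)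
  · rintro (h | h)
    · exact mem_part_of_reflTransGen_isArc hi h
    · rw [P.mem_part_iff_part_eq_part hj hi, eq_comm, ← P.mem_part_iff_part_eq_part hi hj]
      exact mem_part_of_reflTransGen_isArc hj h

theorem arcs_injective : Function.Injective (arcs (s := s)) := by
  intro P Q h
  have hR : IsArc P = IsArc Q := by
    ext i j
    rw [← mem_arcs, h, mem_arcs]
  have hparts (P : Finpartition s) : P.parts = s.image P.part := by
    ext B
    simp only [mem_image]
    constructor
    · exact fun hB => P.part_surjOn hB
    · rintro ⟨a, ha, rfl⟩
      exact P.part_mem.2 ha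
  ext1
  rw [hparts, hparts]
  refine image_congr fun a ha => ?_
  ext b
  by_cases hb : b ∈ s
  · rw [mem_part_iff_reflTransGen_isArc ha hb, mem_part_iff_reflTransGen_isArc ha hb, hR]
  · exact ⟨fun h => absurd (P.part_subset a h) hb, fun h => absurd (Q.part_subset a h) hb⟩

theorem le_of_reflTransGen {A : Finset (ℕ × ℕ)} (hA : IsArcSet s A)
    (h : ReflTransGen (fun u v => (u, v) ∈ A) i j) : i ≤ j := by
  induction h with
  | refl => exact le_rfl
  | tail _ hbc ih => exact ih.trans (hA.1 _ _ hbc).2.2.le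

theorem exists_arcs_eq {A : Finset (ℕ × ℕ)} (hA : IsArcSet s A) :
    ∃ P : Finpartition s, arcs P = A := by
  classical
  let R : ℕ → ℕ → Prop := fun u v => (u, v) ∈ A
  have hr : Relator.RightUnique R := fun i j j' => hA.2.1 i j j'
  have hl : Relator.RightUnique (Function.swap R) := fun j i i' => hA.2.2 i i' j
  let S : Setoid ℕ :=
    { r := fun u v => ReflTransGen R u v ∨ ReflTransGen R v u
      iseqv :=
        { refl := fun _ => .inl .refl
          symm := Or.symm
          trans := by
            rintro x y z (hxy | hxy) (hyz | hyz)
            · exact .inl (hxy.trans hyz)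
            · rw [← reflTransGen_swap] at hxy hyz
              exact (ReflTransGen.total_of_right_unique hl hxy hyz).symm.imp
                reflTransGen_swap.1 reflTransGen_swap.1
            · exact ReflTransGen.total_of_right_unique hr hxy hyz
            · exact .inr (hyz.trans hxy) } }
  have hS (i j : ℕ) : S i j ↔ ReflTransGen R i j ∨ ReflTransGen R j i := Iff.rfl
  refine ⟨Finpartition.ofSetSetoid S s, ?_⟩
  ext ⟨i, j⟩
  rw [mem_arcs, isArc_iff]
  simp only [Finpartition.mem_part_ofSetSetoid_iff_rel, hS]
  constructor
  · rintro ⟨hij, ⟨hi, hj, h⟩, hno⟩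
    have h' : ReflTransGen R i j :=
      h.resolve_right fun h => by have := le_of_reflTransGen hA h; omega
    obtain rfl | ⟨x, hix, hxj⟩ := h'.cases_head
    · omega
    have hx := hA.1 _ _ hix
    have := le_of_reflTransGen hA hxj
    have := hno x ⟨hi, hx.2.1, .inl (.single hix)⟩
    obtain rfl : x = j := by omega
    exact hix
  · intro h
    have hij := hA.1 _ _ h
    refine ⟨hij.2.2, ⟨hij.1, hij.2.1, .inl (.single h)⟩, ?_⟩
    rintro l ⟨-, -, hil | hil⟩ ⟨h1, h2⟩
    · obtain rfl | ⟨x, hix, hxl⟩ := hil.cases_head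
      · omega
      obtain rfl := hA.2.1 _ _ _ h hix
      have := le_of_reflTransGen hA hxl
      omega
    · have := le_of_reflTransGen hA hil
      omega

theorem card_parts_add_card_arcs (P : Finpartition s) : #P.parts + #(arcs P) = #s := by
  classical
  have hA := isArcSet_arcs P
  have hsnd : #((arcs P).image Prod.snd) = #(arcs P) := by
    refine card_image_of_injOn ?_
    rintro ⟨i, j⟩ h ⟨i', j'⟩ h' rfl
    rw [hA.2.2 i i' j h h']
  have hsub : (arcs P).image Prod.snd ⊆ s := by
    intro j
    simp only [mem_image, Prod.exists, exists_eq_right]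
    rintro ⟨i, h⟩
    exact (hA.1 i j h).2.1
  rw [← hsnd, ← card_sdiff_add_card_eq_card hsub, Nat.add_right_cancel_iff]
  symm
  refine card_bij (fun a _ => P.part a) ?_ ?_ ?_
  · intro a ha
    exact P.part_mem.2 (mem_sdiff.1 ha).1
  · have key : ∀ a ∈ s, ∀ b ∈ s \ (arcs P).image Prod.snd, P.part a = P.part b → b ≤ a := by
      intro a ha b hb hab
      by_contra! hlt
      simp only [mem_sdiff, mem_image, Prod.exists, exists_eq_right, not_exists] at hb
      have hmem : b ∈ P.part a := hab ▸ P.mem_part hb.1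
      obtain rfl | ⟨x, -, hxb⟩ :=
        (reflTransGen_isArc (P.part_mem.2 ha) (P.mem_part ha) hmem hlt.le).cases_tail
      · omega
      · exact hb.2 x (mem_arcs.2 hxb)
    intro a ha b hb hab
    exact le_antisymm (key b (mem_sdiff.1 hb).1 a ha hab.symm) (key a (mem_sdiff.1 ha).1 b hb hab)
  · intro B hB
    have hne := P.nonempty_of_mem_parts hB
    have hm := B.min'_mem hne
    refine ⟨B.min' hne, ?_, P.part_eq_of_mem hB hm⟩
    simp only [mem_sdiff, mem_image, Prod.exists, exists_eq_right, not_exists, mem_arcs]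
    refine ⟨P.le hB hm, ?_⟩
    rintro i ⟨h, B', hB', hi, hj, -⟩
    obtain rfl := P.eq_of_mem_parts hB hB' hm hj
    have := min'_le _ _ hi
    omega

open scoped Classical in
theorem partPoly_eq_sum_arcSets (s : Finset ℕ) {pr : Finpartition s → Prop}
    {q : Finset (ℕ × ℕ) → Prop} (h : ∀ P, pr P ↔ ¬q (arcs P)) :
    partPoly s pr = ∑ A ∈ arcSets s, if ¬q A then (X : ℤ[X]) ^ (#s - #A) else 0 := by
  rw [partPoly]
  refine sum_bij (fun P _ => arcs P) (fun P _ => mem_arcSets.2 (isArcSet_arcs P))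
    (fun P _ Q _ h => arcs_injective h) ?_ ?_
  · intro A hA
    obtain ⟨P, hP⟩ := exists_arcs_eq (mem_arcSets.1 hA)
    exact ⟨P, mem_univ _, hP⟩
  · intro P _
    rw [← card_parts_add_card_arcs P, Nat.add_sub_cancel]
    simp [h]

end Arcs

section Crossing

variable {s : Finset ℕ} {P : Finpartition s} {k : ℕ}

theorem hasKCrossing_iff : HasKCrossing P k ↔ HasStrictCrossing (arcs P) k := by
  simp only [HasKCrossing, HasStrictCrossing, mem_arcs]
  refine exists_congr fun f => exists_congr fun g => and_congr_right fun hf =>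
    and_congr_right fun hg => ⟨fun h => ⟨fun m => ?_, h.2⟩, fun h => ⟨fun m => .inl (h.1 m), h.2⟩⟩
  exact (h.1 m).resolve_right fun h' => (h.2 m m).ne h'.1

/-- A strictly increasing family of at least two arcs in which all left ends are at most all right
ends contains no loop. -/
theorem left_ne_right_of_forall_le {f g : Fin k → ℕ} (hk : 2 ≤ k) (hf : StrictMono f) (hg : StrictMono g)
    (h : ∀ a b, f a ≤ g b) (m : Fin k) : f m ≠ g m := by
  intro hm
  obtain ⟨c, hc⟩ : ∃ c : Fin k, c ≠ m := by
    have : Nontrivial (Fin k) := Fin.nontrivial_iff_two_le.2 hk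
    exact exists_ne m
  rcases lt_or_gt_of_ne hc with hlt | hlt
  · have := hg hlt
    have := h m c
    omega
  · have := hf hlt
    have := h c m
    omega

theorem hasEnhancedKCrossing_iff (hk : 2 ≤ k) :
    HasEnhancedKCrossing P k ↔ HasLooseCrossing (arcs P) k := by
  constructor
  · rintro (h | ⟨f, g, hf, hg, harc, a, b, hab, ha, hb⟩)
    · obtain ⟨f, g, hf, hg, harc, h⟩ := hasKCrossing_iff.1 h
      exact ⟨f, g, hf, hg, harc, fun a b => (h a b).le⟩
    · have h (c d : Fin k) : f c ≤ g d := (ha c).trans (hab ▸ hb d)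
      refine ⟨f, g, hf, hg, fun m => mem_arcs.2 ?_, h⟩
      exact (harc m).resolve_right fun h' => left_ne_right_of_forall_le hk hf hg h m h'.1
  · rintro ⟨f, g, hf, hg, harc, h⟩
    simp only [mem_arcs] at harc
    by_cases hlt : ∀ a b, f a < g b
    · exact .inl ⟨f, g, hf, hg, fun m => .inl (harc m), hlt⟩
    · push Not at hlt
      obtain ⟨a, b, hab⟩ := hlt
      have hab := (h a b).antisymm hab
      exact .inr ⟨f, g, hf, hg, fun m => .inl (harc m), a, b, hab,
        fun c => hab ▸ h c b, fun c => hab ▸ h a c⟩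

end Crossing

section Transport

variable {s t : Finset ℕ} {e : ℕ → ℕ} {k : ℕ} {A : Finset (ℕ × ℕ)}

theorem hasLooseCrossing_image_iff (he : StrictMonoOn e s) (hA : IsArcSet s A) :
    HasLooseCrossing (A.image (Prod.map e e)) k ↔ HasLooseCrossing A k := by
  constructor
  · rintro ⟨f, g, hf, hg, harc, h⟩
    have : ∀ m, ∃ p : ℕ × ℕ, p ∈ A ∧ e p.1 = f m ∧ e p.2 = g m := by
      intro m
      obtain ⟨p, hp, hpm⟩ := mem_image.1 (harc m)
      exact ⟨p, hp, by simpa using congrArg Prod.fst hpm, by simpa using congrArg Prod.snd hpm⟩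
    choose p hp hpf hpg using this
    have hs m := hA.1 _ _ (hp m)
    refine ⟨fun m => (p m).1, fun m => (p m).2, fun a b hab => ?_, fun a b hab => ?_, hp,
      fun a b => ?_⟩
    · rw [← he.lt_iff_lt (hs a).1 (hs b).1, hpf, hpf]
      exact hf hab
    · rw [← he.lt_iff_lt (hs a).2.1 (hs b).2.1, hpg, hpg]
      exact hg hab
    · rw [← he.le_iff_le (hs a).1 (hs b).2.1, hpf, hpg]
      exact h a b
  · rintro ⟨f, g, hf, hg, harc, h⟩
    have hs m := hA.1 _ _ (harc m)
    exact ⟨e ∘ f, e ∘ g, fun a b hab => he (hs a).1 (hs b).1 (hf hab),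
      fun a b hab => he (hs a).2.1 (hs b).2.1 (hg hab),
      fun m => mem_image_of_mem (Prod.map e e) (harc m),
      fun a b => (he.le_iff_le (hs a).1 (hs b).2.1).2 (h a b)⟩

theorem mem_image_prodMap_iff (he : StrictMonoOn e s) (hA : IsArcSet s A) {i j : ℕ} (hi : i ∈ s)
    (hj : j ∈ s) : (e i, e j) ∈ A.image (Prod.map e e) ↔ (i, j) ∈ A := by
  constructor
  · rintro h
    obtain ⟨⟨i', j'⟩, hp, h⟩ := mem_image.1 h
    have hs := hA.1 _ _ hp
    simp only [Prod.map_apply, Prod.mk.injEq] at h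
    rwa [← he.injOn hs.1 hi h.1, ← he.injOn hs.2.1 hj h.2]
  · exact fun h => mem_image_of_mem (Prod.map e e) h

theorem IsArcSet.image (he : StrictMonoOn e s) (hst : s.image e = t) (hA : IsArcSet s A) :
    IsArcSet t (A.image (Prod.map e e)) := by
  have hmem : ∀ i j, (i, j) ∈ A.image (Prod.map e e) →
      ∃ i' ∈ s, ∃ j' ∈ s, e i' = i ∧ e j' = j ∧ i' < j' := by
    intro i j h
    obtain ⟨⟨i', j'⟩, hp, h⟩ := mem_image.1 h
    have hs := hA.1 _ _ hp
    simp only [Prod.map_apply, Prod.mk.injEq] at h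
    exact ⟨i', hs.1, j', hs.2.1, h.1, h.2, hs.2.2⟩
  subst hst
  refine ⟨?_, ?_, ?_⟩
  · intro i j h
    obtain ⟨i', hi', j', hj', rfl, rfl, hlt⟩ := hmem i j h
    exact ⟨mem_image_of_mem e hi', mem_image_of_mem e hj', he hi' hj' hlt⟩
  · intro i j j₂ h h₂
    obtain ⟨i', hi', j', hj', rfl, rfl, -⟩ := hmem i j h
    obtain ⟨-, -, j'', hj'', -, rfl, -⟩ := hmem _ j₂ h₂
    rw [mem_image_prodMap_iff he hA hi'] at h h₂ <;> try assumption
    rw [hA.2.1 _ _ _ h h₂]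
  · intro i i₂ j h h₂
    obtain ⟨i', hi', j', hj', rfl, rfl, -⟩ := hmem i j h
    obtain ⟨i'', hi'', -, -, rfl, -, -⟩ := hmem i₂ _ h₂
    rw [mem_image_prodMap_iff he hA] at h h₂ <;> try assumption
    rw [hA.2.2 _ _ _ h h₂]

open scoped Classical in
theorem sum_arcSets_image (he : StrictMonoOn e s) (hst : s.image e = t) (k : ℕ) :
    (∑ A ∈ arcSets s, if ¬HasLooseCrossing A k then (X : ℤ[X]) ^ (#s - #A) else 0) =
      ∑ A ∈ arcSets t, if ¬HasLooseCrossing A k then (X : ℤ[X]) ^ (#t - #A) else 0 := by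
  refine sum_bij (fun A _ => A.image (Prod.map e e)) ?_ ?_ ?_ ?_
  · exact fun A hA => mem_arcSets.2 ((mem_arcSets.1 hA).image he hst)
  · intro A hA B hB hAB
    rw [mem_arcSets] at hA hB
    ext ⟨i, j⟩
    by_cases h : i ∈ s ∧ j ∈ s
    · rw [← mem_image_prodMap_iff he hA h.1 h.2, ← mem_image_prodMap_iff he hB h.1 h.2, hAB]
    · exact ⟨fun h' => absurd ⟨(hA.1 _ _ h').1, (hA.1 _ _ h').2.1⟩ h,
        fun h' => absurd ⟨(hB.1 _ _ h').1, (hB.1 _ _ h').2.1⟩ h⟩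
  · intro B hB
    rw [mem_arcSets] at hB
    refine ⟨{p ∈ s ×ˢ s | (e p.1, e p.2) ∈ B}, mem_arcSets.2 ⟨?_, ?_, ?_⟩, ?_⟩
    · intro i j h
      simp only [mem_filter, mem_product] at h
      exact ⟨h.1.1, h.1.2, (he.lt_iff_lt h.1.1 h.1.2).1 (hB.1 _ _ h.2).2.2⟩
    · intro i j j' h h'
      simp only [mem_filter, mem_product] at h h'
      exact he.injOn h.1.2 h'.1.2 (hB.2.1 _ _ _ h.2 h'.2)
    · intro i i' j h h'
      simp only [mem_filter, mem_product] at h h'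
      exact he.injOn h.1.1 h'.1.1 (hB.2.2 _ _ _ h.2 h'.2)
    · ext ⟨i, j⟩
      simp only [mem_image, mem_filter, mem_product, Prod.exists, Prod.map_apply, Prod.mk.injEq]
      constructor
      · rintro ⟨a, b, ⟨-, h⟩, rfl, rfl⟩
        exact h
      · intro h
        have ht := hB.1 _ _ h
        rw [← hst, mem_image, mem_image] at ht
        obtain ⟨⟨a, ha, rfl⟩, ⟨b, hb, rfl⟩, -⟩ := ht
        exact ⟨a, b, ⟨⟨ha, hb⟩, h⟩, rfl, rfl⟩
  · intro A hA
    rw [mem_arcSets] at hA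
    have hcard : #(A.image (Prod.map e e)) = #A := by
      refine card_image_of_injOn ?_
      rintro ⟨i, j⟩ h ⟨i', j'⟩ h' hij
      have hs := hA.1 _ _ h
      have hs' := hA.1 _ _ h'
      simp only [Prod.map_apply, Prod.mk.injEq] at hij
      rw [he.injOn hs.1 hs'.1 hij.1, he.injOn hs.2.1 hs'.2.1 hij.2]
    rw [hcard, ← hst, card_image_of_injOn he.injOn]
    simp only [hasLooseCrossing_image_iff he hA]

theorem exists_strictMonoOn_image_eq_Icc (s : Finset ℕ) :
    ∃ e : ℕ → ℕ, StrictMonoOn e s ∧ s.image e = Icc 1 #s := by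
  have hmono : StrictMonoOn (fun x => Nat.count (· ∈ s) x + 1) s := fun a ha b _ hab =>
    Nat.add_lt_add_right (Nat.count_strict_mono (p := (· ∈ s)) ha hab) 1
  refine ⟨_, hmono, eq_of_subset_of_card_le ?_ ?_⟩
  · intro y hy
    obtain ⟨x, hx, rfl⟩ := mem_image.1 hy
    simp only [mem_Icc]
    refine ⟨by omega, ?_⟩
    rw [Nat.succ_le_iff, Nat.count_eq_card_filter_range]
    refine card_lt_card ⟨fun y hy => (mem_filter.1 hy).2, fun h => ?_⟩
    simpa using h hx
  · rw [card_image_of_injOn hmono.injOn]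
    simp

end Transport

section Shift

variable {n k : ℕ} {T : Finset ℕ} {B : Finset (ℕ × ℕ)}

/-- Move all right ends of the arcs in `B` up by one and join each `i ∈ {1, …, n}` outside `T`
to `i + 1`. -/
def raise (n : ℕ) (T : Finset ℕ) (B : Finset (ℕ × ℕ)) : Finset (ℕ × ℕ) :=
  B.image (fun p => (p.1, p.2 + 1)) ∪ (Icc 1 n \ T).image fun i => (i, i + 1)

theorem mem_raise {i j : ℕ} :
    (i, j + 1) ∈ raise n T B ↔ (i, j) ∈ B ∨ (i ∈ Icc 1 n ∧ i ∉ T ∧ i = j) := by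
  simp only [raise, mem_union, mem_image, Prod.exists, Prod.mk.injEq, mem_sdiff,
    Nat.add_right_cancel_iff]
  constructor
  · rintro (⟨a, b, h, rfl, rfl⟩ | ⟨a, h, rfl, rfl⟩)
    · exact .inl h
    · exact .inr ⟨h.1, h.2, rfl⟩
  · rintro (h | ⟨h, h', rfl⟩)
    · exact .inl ⟨i, j, h, rfl, rfl⟩
    · exact .inr ⟨i, ⟨h, h'⟩, rfl, rfl⟩

theorem notMem_raise_zero {i : ℕ} : (i, 0) ∉ raise n T B := by
  simp [raise]

theorem isArcSet_raise (hT : T ⊆ Icc 1 n) (hB : IsArcSet T B) :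
    IsArcSet (Icc 1 (n + 1)) (raise n T B) := by
  refine ⟨?_, ?_, ?_⟩
  · rintro i (_ | j) h
    · exact absurd h notMem_raise_zero
    rw [mem_raise] at h
    simp only [mem_Icc] at h ⊢
    rcases h with h | h
    · have hs := hB.1 _ _ h
      have h1 := mem_Icc.1 (hT hs.1)
      have h2 := mem_Icc.1 (hT hs.2.1)
      omega
    · omega
  · rintro i (_ | j) (_ | j') h h' <;> try exact absurd ‹_› notMem_raise_zero
    rw [mem_raise] at h h'
    rcases h with h | h <;> rcases h' with h' | h'
    · rw [hB.2.1 _ _ _ h h']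
    · exact absurd (hB.1 _ _ h).1 h'.2.1
    · exact absurd (hB.1 _ _ h').1 h.2.1
    · omega
  · rintro i i' (_ | j) h h'
    · exact absurd h notMem_raise_zero
    rw [mem_raise] at h h'
    rcases h with h | ⟨-, h, rfl⟩ <;> rcases h' with h' | ⟨-, h', rfl⟩
    · exact hB.2.2 _ _ _ h h'
    · exact absurd (hB.1 _ _ h).2.1 h'
    · exact absurd (hB.1 _ _ h').2.1 h
    · rfl

theorem IsArcSet.card_le (hB : IsArcSet T B) : #B ≤ #T := by
  refine card_le_card_of_injOn Prod.snd (fun p hp => (hB.1 p.1 p.2 hp).2.1) ?_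
  rintro ⟨i, j⟩ h ⟨i', j'⟩ h' rfl
  rw [hB.2.2 i i' j h h']

theorem card_raise (hT : T ⊆ Icc 1 n) (hB : IsArcSet T B) : #(raise n T B) = #B + (n - #T) := by
  rw [raise, card_union_of_disjoint, card_image_of_injective, card_image_of_injective,
    card_sdiff_of_subset hT, Nat.card_Icc, Nat.add_sub_cancel]
  · exact fun a b h => (Prod.mk.inj h).1
  · rintro ⟨a, b⟩ ⟨c, d⟩ h
    simpa using h
  · rw [disjoint_left]
    rintro ⟨i, j⟩ h h'
    obtain ⟨⟨a, b⟩, hab, h⟩ := mem_image.1 h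
    obtain ⟨c, hc, h'⟩ := mem_image.1 h'
    simp only [Prod.mk.injEq] at h h'
    obtain rfl : a = c := by omega
    exact (mem_sdiff.1 hc).2 (hB.1 _ _ hab).1

theorem hasStrictCrossing_raise_iff (hk : 2 ≤ k) :
    HasStrictCrossing (raise n T B) k ↔ HasLooseCrossing B k := by
  constructor
  · rintro ⟨f, g, hf, hg, harc, h⟩
    have hg' : StrictMono fun m => g m - 1 := by
      intro a b hab
      have := hg hab
      have := h a a
      dsimp only
      omega
    have h' (a b : Fin k) : f a ≤ g b - 1 := Nat.le_sub_one_of_lt (h a b)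
    refine ⟨f, fun m => g m - 1, hf, hg', fun m => ?_, h'⟩
    have hm := harc m
    obtain ⟨j, hj⟩ : ∃ j, g m = j + 1 := Nat.exists_eq_add_one.2 ((Nat.zero_le _).trans_lt (h m m))
    rw [hj, mem_raise] at hm
    have hj' : g m - 1 = j := by omega
    dsimp only
    rw [hj']
    refine hm.resolve_right fun hm => left_ne_right_of_forall_le hk hf hg' h' m ?_
    omega
  · rintro ⟨f, g, hf, hg, harc, h⟩
    exact ⟨f, fun m => g m + 1, hf, fun a b hab => Nat.add_lt_add_right (hg hab) 1,
      fun m => mem_raise.2 (.inl (harc m)), fun a b => Nat.lt_add_one_of_le (h a b)⟩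

theorem exists_raise_eq {A : Finset (ℕ × ℕ)} (hA : IsArcSet (Icc 1 (n + 1)) A) :
    ∃ T ⊆ Icc 1 n, ∃ B, IsArcSet T B ∧ raise n T B = A := by
  refine ⟨{i ∈ Icc 1 n | (i, i + 1) ∉ A}, filter_subset _ _,
    {p ∈ Icc 1 n ×ˢ Icc 1 n | (p.1, p.2 + 1) ∈ A ∧ p.1 ≠ p.2}, ⟨?_, ?_, ?_⟩, ?_⟩
  · intro i j h
    simp only [mem_filter, mem_product] at h ⊢
    obtain ⟨⟨hi, hj⟩, h, hne⟩ := h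
    refine ⟨⟨hi, fun h' => hne ?_⟩, ⟨hj, fun h' => hne (hA.2.2 _ _ _ h h')⟩, ?_⟩
    · have := hA.2.1 _ _ _ h h'
      omega
    · have := hA.1 _ _ h
      omega
  · intro i j j' h h'
    simp only [mem_filter, mem_product] at h h'
    have := hA.2.1 _ _ _ h.2.1 h'.2.1
    omega
  · intro i i' j h h'
    simp only [mem_filter, mem_product] at h h'
    exact hA.2.2 _ _ _ h.2.1 h'.2.1
  · ext ⟨i, _ | j⟩
    · refine ⟨fun h => absurd h notMem_raise_zero, fun h => ?_⟩
      have := (hA.1 _ _ h).2.2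
      omega
    · rw [mem_raise]
      simp only [mem_filter, mem_product, not_and, not_not]
      constructor
      · rintro (h | ⟨hi, h, rfl⟩)
        · exact h.2.1
        · exact h hi
      · intro h
        have hs := hA.1 _ _ h
        simp only [mem_Icc] at hs ⊢
        by_cases hij : i = j
        · subst hij
          exact .inr ⟨by omega, fun _ => h, rfl⟩
        · exact .inl ⟨by omega, h, hij⟩

theorem raise_injective {T' : Finset ℕ} {B' : Finset (ℕ × ℕ)} (hT : T ⊆ Icc 1 n)
    (hT' : T' ⊆ Icc 1 n) (hB : IsArcSet T B) (hB' : IsArcSet T' B')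
    (h : raise n T B = raise n T' B') : T = T' ∧ B = B' := by
  have key : ∀ {T B}, T ⊆ Icc 1 n → IsArcSet T B →
      T = {i ∈ Icc 1 n | (i, i + 1) ∉ raise n T B} ∧
      ∀ i j, (i, j) ∈ B ↔ (i, j + 1) ∈ raise n T B ∧ i ≠ j := by
    intro T B hT hB
    have hne : ∀ i j, (i, j) ∈ B → i ≠ j := fun i j h => (hB.1 _ _ h).2.2.ne
    constructor
    · ext i
      simp only [mem_filter, mem_raise]
      constructor
      · intro hi
        refine ⟨hT hi, ?_⟩
        rintro (h | h)
        · exact hne _ _ h rfl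
        · exact h.2.1 hi
      · rintro ⟨hi, h⟩
        by_contra hiT
        exact h (.inr (by simp [hi, hiT]))
    · intro i j
      rw [mem_raise]
      constructor
      · exact fun h => ⟨.inl h, hne _ _ h⟩
      · rintro ⟨h | h, hij⟩
        · exact h
        · exact absurd h.2.2 hij
  refine ⟨?_, ?_⟩
  · rw [(key hT hB).1, (key hT' hB').1, h]
  · ext ⟨i, j⟩
    rw [(key hT hB).2, (key hT' hB').2, h]

open scoped Classical in
theorem sum_arcSets_Icc_succ (n : ℕ) (hk : 2 ≤ k) :
    (∑ A ∈ arcSets (Icc 1 (n + 1)),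
        if ¬HasStrictCrossing A k then (X : ℤ[X]) ^ (#(Icc 1 (n + 1)) - #A) else 0) =
      X * ∑ T ∈ (Icc 1 n).powerset, ∑ B ∈ arcSets T,
        if ¬HasLooseCrossing B k then (X : ℤ[X]) ^ (#T - #B) else 0 := by
  rw [mul_sum, sum_congr rfl fun T _ => mul_sum .., sum_sigma']
  symm
  refine sum_bij (fun p _ => raise n p.1 p.2) ?_ ?_ ?_ ?_
  · rintro ⟨T, B⟩ h
    simp only [mem_sigma, mem_powerset, mem_arcSets] at h ⊢
    exact isArcSet_raise h.1 h.2
  · rintro ⟨T, B⟩ h ⟨T', B'⟩ h' heq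
    simp only [mem_sigma, mem_powerset, mem_arcSets] at h h'
    obtain ⟨rfl, rfl⟩ := raise_injective h.1 h'.1 h.2 h'.2 heq
    rfl
  · intro A hA
    obtain ⟨T, hT, B, hB, rfl⟩ := exists_raise_eq (mem_arcSets.1 hA)
    exact ⟨⟨T, B⟩, by simp only [mem_sigma, mem_powerset, mem_arcSets]; exact ⟨hT, hB⟩, rfl⟩
  · rintro ⟨T, B⟩ h
    simp only [mem_sigma, mem_powerset, mem_arcSets] at h
    have hT := card_le_card h.1
    have hle := h.2.card_le
    simp only [Nat.card_Icc, Nat.add_sub_cancel] at hT ⊢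
    have hcard : n + 1 - #(raise n T B) = #T - #B + 1 := by
      rw [card_raise h.1 h.2]
      omega
    simp only [hasStrictCrossing_raise_iff hk, hcard, mul_ite, mul_zero, pow_succ']

end Shift

/-- For all `n ≥ 1`, `k ≥ 2`, in `ℤ[t]`:
`NC_{n+1}^{(k)}(t) = t ⬝ ∑_{i=0}^n C(n,i) NW_i^{(k)}(t)`, where `NC_m^{(k)}(t)` sums
`t^{#blocks}` over `k`-noncrossing partitions of `{1,…,m}` and `NW_m^{(k)}(t)` sums
`t^{#blocks}` over enhanced `k`-noncrossing partitions of `{1,…,m}` (`NW_0^{(k)}(t)=1`). -/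
theorem stmt0 (n k : ℕ) (hn : 1 ≤ n) (hk : 2 ≤ k) :
    partPoly (Finset.Icc 1 (n + 1)) (fun P => ¬ HasKCrossing P k) =
      X * ∑ i ∈ Finset.range (n + 1),
        (C (n.choose i : ℤ)) *
          partPoly (Finset.Icc 1 i) (fun P => ¬ HasEnhancedKCrossing P k) := by
  classical
  have henh (s : Finset ℕ) := partPoly_eq_sum_arcSets s
    (pr := fun P => ¬HasEnhancedKCrossing P k) (q := fun A => HasLooseCrossing A k)
    fun _ => not_congr (hasEnhancedKCrossing_iff hk)
  rw [partPoly_eq_sum_arcSets _ (q := fun A => HasStrictCrossing A k)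
    fun _ => not_congr hasKCrossing_iff]
  rw [sum_arcSets_Icc_succ n hk]
  have hcard : ∀ T ∈ (Icc 1 n).powerset,
      (∑ B ∈ arcSets T, if ¬HasLooseCrossing B k then (X : ℤ[X]) ^ (#T - #B) else 0) =
        partPoly (Icc 1 #T) fun P => ¬HasEnhancedKCrossing P k := by
    intro T _
    obtain ⟨e, he, hT⟩ := exists_strictMonoOn_image_eq_Icc T
    rw [henh, sum_arcSets_image he hT]
  rw [sum_congr rfl hcard, sum_powerset_apply_card
    (fun i => partPoly (Icc 1 i) fun P => ¬HasEnhancedKCrossing P k)]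
  simp [nsmul_eq_mul]
end

section
/- For every integer n ≥ 0, the Catalan–Motzkin identity C_{n+1} = Σ_{i=0}^{n} C(n,i) · M_i holds, where C_m is the m-th Catalan number and M_i = Σ_{j=0}^{⌊i/2⌋} C(i,2j) · C_j is the i-th Motzkin number. -/
/-- The `i`-th Motzkin number, `M_i = ∑_{j=0}^{⌊i/2⌋} C(i,2j) ⬝ Catalan(j)`. -/
def motzkin (i : ℕ) : ℕ := ∑ j ∈ Finset.range (i / 2 + 1), i.choose (2 * j) * catalan j

open Polynomial in
/-- The coefficients of `(P + X) ^ n` of index at least `n`, in terms of the powers of `P`. -/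
theorem coeff_add_X_pow_add (P : ℤ[X]) (n d : ℕ) :
    ((P + X) ^ n).coeff (n + d) =
      ∑ i ∈ Finset.range (n + 1), (n.choose i : ℤ) * (P ^ i).coeff (i + d) := by
  rw [add_pow, finsetSum_coeff]
  refine Finset.sum_congr rfl fun i hi => ?_
  have hin : n + d = (i + d) + (n - i) := by
    have := Finset.mem_range.mp hi
    omega
  rw [← C_eq_natCast, coeff_mul_C, hin, coeff_mul_X_pow, mul_comm]

theorem choose_two_mul_eq_add_catalan (j : ℕ) :
    (2 * j).choose j = (2 * j).choose (j + 1) + catalan j := by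
  have h := Nat.choose_succ_right_eq (2 * j) j
  have h' := succ_mul_catalan_eq_centralBinom j
  rw [Nat.centralBinom_eq_two_mul_choose] at h'
  rw [show 2 * j - j = j by omega] at h
  refine Nat.eq_of_mul_eq_mul_left (Nat.succ_pos j) ?_
  simp only [Nat.succ_eq_add_one]
  linarith

theorem choose_two_mul_eq_add_catalan_succ (n : ℕ) :
    (2 * n).choose n = (2 * n).choose (n + 2) + catalan (n + 1) := by
  have h := choose_two_mul_eq_add_catalan (n + 1)
  have h₁ : (2 * n + 1).choose n = (2 * n + 1).choose (n + 1) :=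
    (Nat.choose_symm_half n).symm
  rw [show 2 * (n + 1) = 2 * n + 1 + 1 by ring, Nat.choose_succ_succ' (2 * n + 1) n,
    Nat.choose_succ_succ' (2 * n + 1) (n + 1), h₁, Nat.choose_succ_succ' (2 * n) n,
    Nat.choose_succ_succ' (2 * n) (n + 1)] at h
  simp only [add_assoc, Nat.reduceAdd] at h
  omega

open Polynomial in
theorem coeff_one_add_X_sq_pow_two_mul (k m : ℕ) :
    ((1 + X ^ 2 : ℤ[X]) ^ k).coeff (2 * m) = k.choose m := by
  have h : (1 + X ^ 2 : ℤ[X]) ^ k = expand ℤ 2 ((1 + X) ^ k) := by simp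
  rw [h, mul_comm, coeff_expand_mul two_pos, coeff_one_add_X_pow]

open Polynomial in
theorem coeff_one_add_X_sq_pow_of_odd (k : ℕ) {m : ℕ} (hm : ¬ 2 ∣ m) :
    ((1 + X ^ 2 : ℤ[X]) ^ k).coeff m = 0 := by
  have h : (1 + X ^ 2 : ℤ[X]) ^ k = expand ℤ 2 ((1 + X) ^ k) := by simp
  rw [h, coeff_expand two_pos, if_neg hm]

open Polynomial in
theorem motzkin_eq_coeff_sub_coeff (i : ℕ) :
    (motzkin i : ℤ) =
      ((1 + X ^ 2 + X : ℤ[X]) ^ i).coeff i - ((1 + X ^ 2 + X : ℤ[X]) ^ i).coeff (i + 2) := by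
  have h₀ := coeff_add_X_pow_add (1 + X ^ 2) i 0
  simp only [add_zero] at h₀
  rw [h₀, coeff_add_X_pow_add, ← Finset.sum_sub_distrib, motzkin, Nat.cast_sum]
  refine Finset.sum_of_injOn (2 * ·) (fun a _ b _ h => by simpa using h) ?_ ?_ ?_
  · intro j hj
    simp only [Finset.coe_range, Set.mem_Iio] at hj ⊢
    omega
  · intro k hk hk'
    have hodd : ¬ 2 ∣ k := by
      rintro ⟨j, rfl⟩
      refine hk' ⟨j, ?_, rfl⟩
      simp only [Finset.coe_range, Set.mem_Iio, Finset.mem_range] at hk ⊢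
      omega
    rw [coeff_one_add_X_sq_pow_of_odd k hodd,
      coeff_one_add_X_sq_pow_of_odd k (m := k + 2) (by omega)]
    simp
  · intro j _
    have h := choose_two_mul_eq_add_catalan j
    simp only [show 2 * j + 2 = 2 * (j + 1) by ring, coeff_one_add_X_sq_pow_two_mul, h]
    push_cast
    ring

/-- For every `n ≥ 0`, `C_{n+1} = ∑_{i=0}^n C(n,i) ⬝ M_i`. -/
theorem stmt2 (n : ℕ) :
    catalan (n + 1) = ∑ i ∈ Finset.range (n + 1), n.choose i * motzkin i := by
  have hsq : (1 + Polynomial.X ^ 2 + Polynomial.X + Polynomial.X : Polynomial ℤ) ^ n = (1 + Polynomial.X) ^ (2 * n) := by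
    rw [pow_mul]
    ring
  have h₀ := coeff_add_X_pow_add (1 + Polynomial.X ^ 2 + Polynomial.X) n 0
  have h₂ := coeff_add_X_pow_add (1 + Polynomial.X ^ 2 + Polynomial.X) n 2
  simp only [add_zero] at h₀
  rw [hsq, Polynomial.coeff_one_add_X_pow] at h₀ h₂
  have h := choose_two_mul_eq_add_catalan_succ n
  zify at h ⊢
  simp only [motzkin_eq_coeff_sub_coeff, mul_sub, Finset.sum_sub_distrib, ← h₀, ← h₂]
  linarith
end

section
/- For every integer n ≥ 0, the polynomial identity C_{n+1}(t) = t · Σ_{i=0}^{n} C(n,i) · M_i(t) holds in ℤ[t], where C_{m}(t) is the sum of t^{(number of blocks of P)} over all noncrossing partitions P of {1,…,m} and M_i(t) is the sum of t^{(number of blocks of μ)} over all noncrossing partial matchings μ of {1,…,i}, with M_0(t) = 1 by convention. -/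
open Finset Polynomial

/-- A partial matching: every block has size one or two. -/
def IsPartialMatching {s : Finset ℕ} (P : Finpartition s) : Prop :=
  ∀ B ∈ P.parts, B.card = 1 ∨ B.card = 2

/-- The function sending each element of `s` to the minimum of its block, and fixing every
natural number outside `s`. -/
noncomputable def minRep {s : Finset ℕ} (P : Finpartition s) (i : ℕ) : ℕ :=
  if h : i ∈ s then (P.part i).min' (P.part_nonempty.2 h) else i

section MinRep

variable {s : Finset ℕ} (P : Finpartition s)

theorem minRep_of_notMem {i : ℕ} (h : i ∉ s) : minRep P i = i := by
  simp [minRep, h]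

theorem minRep_mem_part {i : ℕ} (h : i ∈ s) : minRep P i ∈ P.part i := by
  simp only [minRep, h, dif_pos]
  exact Finset.min'_mem _ _

theorem minRep_mem {i : ℕ} (h : i ∈ s) : minRep P i ∈ s :=
  P.part_subset i (minRep_mem_part P h)

theorem minRep_le_of_mem_part {i j : ℕ} (h : j ∈ P.part i) : minRep P i ≤ j := by
  have hi : i ∈ s := P.part_nonempty.1 ⟨j, h⟩
  simp only [minRep, hi, dif_pos]
  exact Finset.min'_le _ _ h

theorem minRep_le (i : ℕ) : minRep P i ≤ i := by
  by_cases h : i ∈ s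
  · exact minRep_le_of_mem_part P (P.mem_part_self.2 h)
  · exact (minRep_of_notMem P h).le

theorem minRep_eq_iff_mem_part {i j : ℕ} (hi : i ∈ s) (hj : j ∈ s) :
    minRep P j = minRep P i ↔ j ∈ P.part i := by
  constructor
  · intro h
    have h1 := minRep_mem_part P hi
    have h2 := minRep_mem_part P hj
    rw [h] at h2
    rw [P.mem_part_iff_part_eq_part (minRep_mem P hi) hi] at h1
    rw [P.mem_part_iff_part_eq_part (minRep_mem P hi) hj] at h2
    rw [P.mem_part_iff_part_eq_part hj hi, ← h1, ← h2]
  · intro h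
    rw [P.mem_part_iff_part_eq_part hj hi] at h
    simp only [minRep, hi, hj, dif_pos, h]

theorem minRep_eq_of_mem_parts {B : Finset ℕ} (hB : B ∈ P.parts) {i j : ℕ} (hi : i ∈ B)
    (hj : j ∈ B) : minRep P j = minRep P i := by
  rw [minRep_eq_iff_mem_part P (P.le hB hi) (P.le hB hj), P.part_eq_of_mem hB hi]
  exact hj

theorem minRep_minRep (i : ℕ) : minRep P (minRep P i) = minRep P i := by
  by_cases h : i ∈ s
  · exact (minRep_eq_iff_mem_part P h (minRep_mem P h)).2 (minRep_mem_part P h)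
  · rw [minRep_of_notMem P h, minRep_of_notMem P h]

theorem minRep_injective : Function.Injective (minRep (s := s)) := by
  intro P Q h
  have hpart : ∀ i ∈ s, P.part i = Q.part i := by
    intro i hi
    ext j
    by_cases hj : j ∈ s
    · rw [← minRep_eq_iff_mem_part P hi hj, ← minRep_eq_iff_mem_part Q hi hj, h]
    · exact iff_of_false (fun h => hj (P.part_subset i h)) (fun h => hj (Q.part_subset i h))
  ext B
  constructor
  · intro hB
    obtain ⟨i, hi⟩ := P.nonempty_of_mem_parts hB
    rw [← P.part_eq_of_mem hB hi, hpart i (P.le hB hi)]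
    exact Q.part_mem.2 (P.le hB hi)
  · intro hB
    obtain ⟨i, hi⟩ := Q.nonempty_of_mem_parts hB
    rw [← Q.part_eq_of_mem hB hi, ← hpart i (Q.le hB hi)]
    exact P.part_mem.2 (Q.le hB hi)

theorem card_parts_eq_card_fixed : P.parts.card = #{i ∈ s | minRep P i = i} := by
  symm
  refine Finset.card_bij (fun i _ => P.part i) ?_ ?_ ?_
  · intro i hi
    exact P.part_mem.2 (Finset.mem_filter.1 hi).1
  · intro i hi j hj h
    rw [Finset.mem_filter] at hi hj
    rw [← hi.2, ← hj.2, minRep_eq_iff_mem_part P hj.1 hi.1, ← h]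
    exact P.mem_part_self.2 hi.1
  · intro B hB
    obtain ⟨i, hi⟩ := P.nonempty_of_mem_parts hB
    have his := P.le hB hi
    refine ⟨minRep P i, Finset.mem_filter.2 ⟨minRep_mem P his, minRep_minRep P i⟩, ?_⟩
    apply P.part_eq_of_mem hB
    rw [← P.part_eq_of_mem hB hi]
    exact minRep_mem_part P his

/-- A function is the block-minimum function of a partition as soon as it is idempotent,
decreasing, preserves `s` and fixes its complement. -/
theorem exists_minRep_eq {f : ℕ → ℕ} (h_out : ∀ i ∉ s, f i = i) (h_mem : ∀ i ∈ s, f i ∈ s)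
    (h_le : ∀ i, f i ≤ i) (h_idem : ∀ i, f (f i) = f i) :
    ∃ P : Finpartition s, minRep P = f := by
  classical
  refine ⟨Finpartition.ofSetSetoid (Setoid.ker f) s, ?_⟩
  ext i
  by_cases hi : i ∈ s
  · apply le_antisymm
    · apply minRep_le_of_mem_part
      rw [Finpartition.mem_part_ofSetSetoid_iff_rel]
      exact ⟨hi, h_mem i hi, (h_idem i).symm⟩
    · have h := minRep_mem_part (Finpartition.ofSetSetoid (Setoid.ker f) s) hi
      rw [Finpartition.mem_part_ofSetSetoid_iff_rel] at h
      have h2 : f i = f _ := h.2.2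
      rw [h2]
      exact h_le _
  · rw [minRep_of_notMem _ hi, h_out i hi]

/-- A block avoiding `q` but with elements on both sides of `q` has an arc over `q`. -/
theorem exists_isArc_over {B : Finset ℕ} (hB : B ∈ P.parts) {p q r : ℕ} (hp : p ∈ B)
    (hr : r ∈ B) (hq : q ∉ B) (hpq : p < q) (hqr : q < r) :
    ∃ x y, IsArc P x y ∧ x ∈ B ∧ y ∈ B ∧ p ≤ x ∧ x < q ∧ q < y ∧ y ≤ r := by
  have h1 : (B.filter (· < q)).Nonempty := ⟨p, by simp [hp, hpq]⟩
  have h2 : (B.filter (q < ·)).Nonempty := ⟨r, by simp [hr, hqr]⟩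
  have hx := Finset.max'_mem _ h1
  have hy := Finset.min'_mem _ h2
  have hx' : ∀ z ∈ B.filter (· < q), z ≤ (B.filter (· < q)).max' h1 := Finset.le_max' _
  have hy' : ∀ z ∈ B.filter (q < ·), (B.filter (q < ·)).min' h2 ≤ z := Finset.min'_le _
  generalize (B.filter (· < q)).max' h1 = x at *
  generalize (B.filter (q < ·)).min' h2 = y at *
  simp only [Finset.mem_filter] at hx hy hx' hy'
  refine ⟨x, y, ⟨by omega, B, hB, hx.1, hy.1, ?_⟩, hx.1, hy.1, hx' p ⟨hp, hpq⟩, hx.2, hy.2,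
    hy' r ⟨hr, hqr⟩⟩
  rintro l hl ⟨h3, h4⟩
  rcases lt_trichotomy l q with h | h | h
  · have := hx' l ⟨hl, h⟩; omega
  · exact hq (h ▸ hl)
  · have := hy' l ⟨hl, h⟩; omega

theorem hasKCrossing_two_iff :
    HasKCrossing P 2 ↔ ∃ i₁ i₂ j₁ j₂, IsArc P i₁ j₁ ∧ IsArc P i₂ j₂ ∧
      i₁ < i₂ ∧ i₂ < j₁ ∧ j₁ < j₂ := by
  constructor
  · rintro ⟨f, g, hf, hg, harc, hlt⟩
    have isArc : ∀ m, IsArc P (f m) (g m) := fun m =>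
      (harc m).resolve_right fun h => (hlt m m).ne h.1
    exact ⟨f 0, f 1, g 0, g 1, isArc 0, isArc 1, hf (by decide), hlt 1 0, hg (by decide)⟩
  · rintro ⟨i₁, i₂, j₁, j₂, h1, h2, h3, h4, h5⟩
    refine ⟨![i₁, i₂], ![j₁, j₂], ?_, ?_, ?_, ?_⟩
    · simpa [Fin.strictMono_iff_lt_succ] using h3
    · simpa [Fin.strictMono_iff_lt_succ] using h5
    · intro m
      left
      fin_cases m
      · exact h1
      · exact h2
    · intro a b
      fin_cases a <;> fin_cases b <;> simp <;> omega

theorem not_hasKCrossing_two_iff :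
    ¬ HasKCrossing P 2 ↔
      ∀ i k, minRep P i ≤ k → k ≤ i → minRep P i ≤ minRep P k := by
  rw [hasKCrossing_two_iff, not_iff_comm]
  constructor
  · intro h
    push Not at h
    obtain ⟨i, k, h1, h2, h3⟩ := h
    have hki : k ≠ i := by rintro rfl; omega
    have hkf : k ≠ minRep P i := by rintro rfl; rw [minRep_minRep] at h3; omega
    have hi : i ∈ s := by
      by_contra hi
      rw [minRep_of_notMem P hi] at h1
      omega
    have hk : k ∈ s := by
      by_contra hk
      rw [minRep_of_notMem P hk] at h3
      omega
    have hA := P.part_mem.2 hk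
    have hB := P.part_mem.2 hi
    have hdisj : ∀ z ∈ P.part k, z ∉ P.part i := by
      intro z hz hz'
      have h4 := minRep_eq_of_mem_parts P hA (P.mem_part_self.2 hk) hz
      have h5 := minRep_eq_of_mem_parts P hB (P.mem_part_self.2 hi) hz'
      omega
    obtain ⟨x, y, hxy, -, hy, -, hx1, hy1, hy2⟩ :=
      exists_isArc_over P hA (minRep_mem_part P hk) (P.mem_part_self.2 hk)
        (fun h => hdisj _ h (minRep_mem_part P hi)) h3 (by omega : minRep P i < k)
    obtain ⟨u, v, huv, -, -, hu1, hu2, hv1, -⟩ :=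
      exists_isArc_over P hB (minRep_mem_part P hi) (P.mem_part_self.2 hi)
        (hdisj y hy) hy1 (by omega : y < i)
    exact ⟨x, u, y, v, hxy, huv, by omega, by omega, by omega⟩
  · rintro ⟨i₁, i₂, j₁, j₂, ⟨-, A, hA, hiA, hjA, hgap⟩, ⟨-, B, hB, hiB, hjB, -⟩, h1, h2, h3⟩ h
    have h4 := minRep_eq_of_mem_parts P hA hiA hjA
    have h5 := minRep_eq_of_mem_parts P hB hiB hjB
    have h6 : minRep P i₂ ≠ minRep P i₁ := by
      intro h6
      rw [minRep_eq_iff_mem_part P (P.le hA hiA) (P.le hB hiB), P.part_eq_of_mem hA hiA] at h6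
      exact hgap _ h6 ⟨h1, h2⟩
    have h7 := minRep_le P i₁
    have h8 := minRep_le P i₂
    have h9 := h j₂ j₁ (by omega) (by omega)
    have h10 := h j₁ i₂ (by omega) (by omega)
    omega

theorem isPartialMatching_iff :
    IsPartialMatching P ↔
      ∀ i j, minRep P i = minRep P j → minRep P i ≠ i → minRep P j ≠ j → i = j := by
  constructor
  · intro h i j hij hi hj
    have his : i ∈ s := not_imp_comm.1 (minRep_of_notMem P) hi
    have hjs : j ∈ s := not_imp_comm.1 (minRep_of_notMem P) hj
    by_contra hne
    have hsub : ({minRep P i, i, j} : Finset ℕ) ⊆ P.part i := by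
      intro z hz
      simp only [Finset.mem_insert, Finset.mem_singleton] at hz
      rcases hz with rfl | rfl | rfl
      · exact minRep_mem_part P his
      · exact P.mem_part_self.2 his
      · exact (minRep_eq_iff_mem_part P his hjs).1 hij.symm
    have hcard := Finset.card_le_card hsub
    rw [Finset.card_eq_three.2 ⟨_, _, _, hi, by rwa [hij], hne, rfl⟩] at hcard
    rcases h _ (P.part_mem.2 his) with h | h <;> omega
  · intro h B hB
    have hpos := (P.nonempty_of_mem_parts hB).card_pos
    by_contra hcard
    have h3 : 2 < B.card := by omega
    obtain ⟨b, hb⟩ := P.nonempty_of_mem_parts hB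
    have h2 : 1 < (B.erase (minRep P b)).card := by
      have := Finset.pred_card_le_card_erase (s := B) (a := minRep P b)
      omega
    obtain ⟨i, hi, j, hj, hij⟩ := Finset.one_lt_card.1 h2
    rw [Finset.mem_erase] at hi hj
    have hfi := minRep_eq_of_mem_parts P hB hb hi.2
    have hfj := minRep_eq_of_mem_parts P hB hb hj.2
    exact hij (h i j (hfi.trans hfj.symm) (by rw [hfi]; exact hi.1.symm)
      (by rw [hfj]; exact hj.1.symm))

end MinRep

/-- The block-minimum functions of noncrossing partitions of `s`. -/
structure IsNoncrossingRep (s : Finset ℕ) (f : ℕ → ℕ) : Prop where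
  out : ∀ i ∉ s, f i = i
  mem : ∀ i ∈ s, f i ∈ s
  le : ∀ i, f i ≤ i
  nested : ∀ i k, f i ≤ k → k ≤ i → f i ≤ f k

/-- Every block of the partition with block-minimum function `f` has at most two elements. -/
def IsMatchingRep (f : ℕ → ℕ) : Prop :=
  ∀ i j, f i = f j → f i ≠ i → f j ≠ j → i = j

theorem isNoncrossingRep_minRep_iff {s : Finset ℕ} (P : Finpartition s) :
    IsNoncrossingRep s (minRep P) ↔ ¬ HasKCrossing P 2 := by
  rw [not_hasKCrossing_two_iff]
  exact ⟨fun h => h.nested, fun h =>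
    ⟨fun _ => minRep_of_notMem P, fun _ => minRep_mem P, minRep_le P, h⟩⟩

open scoped Classical in
/-- The finite set of block-minimum functions of noncrossing partitions of `s`. -/
noncomputable def noncrossingReps (s : Finset ℕ) : Finset (ℕ → ℕ) :=
  {f ∈ (Finset.univ : Finset (Finpartition s)).image minRep | IsNoncrossingRep s f}

theorem mem_noncrossingReps {s : Finset ℕ} {f : ℕ → ℕ} :
    f ∈ noncrossingReps s ↔ IsNoncrossingRep s f := by
  classical
  simp only [noncrossingReps, Finset.mem_filter, Finset.mem_image, Finset.mem_univ, true_and,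
    and_iff_right_iff_imp]
  intro h
  exact exists_minRep_eq h.out h.mem h.le fun i =>
    le_antisymm (h.le _) (h.nested i (f i) le_rfl (h.le i))

open scoped Classical in
/-- The generating polynomial of the noncrossing block-minimum functions on `s` satisfying `Q`,
counted by fixed points in `s`. -/
noncomputable def repPoly (Q : (ℕ → ℕ) → Prop) (s : Finset ℕ) : ℤ[X] :=
  ∑ f ∈ noncrossingReps s with Q f, X ^ #{i ∈ s | f i = i}

theorem partPoly_eq_repPoly {s : Finset ℕ} (pr : Finpartition s → Prop)
    (Q : (ℕ → ℕ) → Prop) (h : ∀ P, pr P ↔ ¬ HasKCrossing P 2 ∧ Q (minRep P)) :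
    partPoly s pr = repPoly Q s := by
  classical
  rw [partPoly, repPoly, ← Finset.sum_filter]
  refine Finset.sum_bij (fun P _ => minRep P) ?_ ?_ ?_ ?_
  · intro P hP
    rw [Finset.mem_filter, mem_noncrossingReps, isNoncrossingRep_minRep_iff, ← h]
    exact (Finset.mem_filter.1 hP).2
  · intro P _ Q _ hPQ
    exact minRep_injective hPQ
  · intro f hf
    rw [Finset.mem_filter] at hf
    have hf1 := hf.1
    simp only [noncrossingReps, Finset.mem_filter, Finset.mem_image, Finset.mem_univ,
      true_and] at hf1
    obtain ⟨⟨P, rfl⟩, hP⟩ := hf1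
    refine ⟨P, ?_, rfl⟩
    rw [Finset.mem_filter, h, ← isNoncrossingRep_minRep_iff]
    exact ⟨Finset.mem_univ _, hP, hf.2⟩
  · intro P _
    rw [card_parts_eq_card_fixed]

theorem isNoncrossingRep_Ico_iff {a b : ℕ} {f : ℕ → ℕ} :
    IsNoncrossingRep (Finset.Ico a b) f ↔
      (∀ i, i < a → f i = i) ∧ (∀ i, b ≤ i → f i = i) ∧ (∀ i, a ≤ i → a ≤ f i) ∧
        (∀ i, f i ≤ i) ∧ ∀ i k, f i ≤ k → k ≤ i → f i ≤ f k := by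
  constructor
  · intro h
    have hb : ∀ i, b ≤ i → f i = i := fun i hi => h.out i (by simp; omega)
    refine ⟨fun i hi => h.out i (by simp; omega), hb, ?_, h.le, h.nested⟩
    intro i hi
    by_cases hib : i < b
    · exact (Finset.mem_Ico.1 (h.mem i (Finset.mem_Ico.2 ⟨hi, hib⟩))).1
    · rwa [hb i (by omega)]
  · rintro ⟨h1, h2, h3, h4, h5⟩
    refine ⟨?_, ?_, h4, h5⟩
    · intro i hi
      rw [Finset.mem_Ico] at hi
      by_cases hia : i < a
      · exact h1 i hia
      · exact h2 i (by omega)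
    · intro i hi
      rw [Finset.mem_Ico] at *
      exact ⟨h3 i hi.1, (h4 i).trans_lt hi.2⟩

/-- The function agreeing with `f` on `[a, b)` and fixing everything else. -/
def restrictIco (f : ℕ → ℕ) (a b : ℕ) (i : ℕ) : ℕ :=
  if a ≤ i ∧ i < b then f i else i

/-- The function agreeing with `f` below `m`, with `g` from `m` on, and sending `b` to `m`. -/
def glueAt (m b : ℕ) (f g : ℕ → ℕ) (i : ℕ) : ℕ :=
  if i = b then m else if i < m then f i else g i

section Glue

variable {a b m : ℕ} {f g : ℕ → ℕ}

theorem IsNoncrossingRep.restrictIco (h : IsNoncrossingRep (Finset.Ico a b) f) {c d : ℕ}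
    (hc : ∀ i, c ≤ i → i < d → c ≤ f i) :
    IsNoncrossingRep (Finset.Ico c d) (restrictIco f c d) := by
  rw [isNoncrossingRep_Ico_iff] at *
  obtain ⟨-, -, -, h4, h5⟩ := h
  unfold _root_.restrictIco
  refine ⟨fun i hi => by grind, fun i hi => by grind, fun i hi => by grind, fun i => by grind,
    fun i k => ?_⟩
  have := h5 i k
  have := hc i
  grind

theorem IsNoncrossingRep.glueAt (hf : IsNoncrossingRep (Finset.Ico a m) f)
    (hg : IsNoncrossingRep (Finset.Ico m b) g) (ham : a ≤ m) (hmb : m < b) :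
    IsNoncrossingRep (Finset.Ico a (b + 1)) (glueAt m b f g) := by
  rw [isNoncrossingRep_Ico_iff] at *
  obtain ⟨f1, f2, f3, f4, f5⟩ := hf
  obtain ⟨g1, g2, g3, g4, g5⟩ := hg
  unfold _root_.glueAt
  refine ⟨fun i hi => by grind, fun i hi => by grind, fun i hi => ?_, fun i => ?_,
    fun i k => ?_⟩
  · have := f3 i hi
    have := g3 i
    split_ifs <;> omega
  · have := f4 i
    have := g4 i
    split_ifs <;> omega
  · have := f5 i k
    have := g5 i k
    have := g3 i
    have := g3 k
    have := g2 i
    have := f4 i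
    have := f4 k
    split_ifs <;> omega

theorem isNoncrossingRep_Ico_iff_succ :
    IsNoncrossingRep (Finset.Ico a b) f ↔
      IsNoncrossingRep (Finset.Ico a (b + 1)) f ∧ f b = b := by
  rw [isNoncrossingRep_Ico_iff, isNoncrossingRep_Ico_iff]
  symm
  constructor
  · rintro ⟨⟨h1, h2, h3⟩, hb⟩
    refine ⟨h1, fun i hi => ?_, h3⟩
    rcases hi.eq_or_lt with rfl | hi
    · exact hb
    · exact h2 i hi
  · rintro ⟨h1, h2, h3⟩
    exact ⟨⟨h1, fun i hi => h2 i (by omega), h3⟩, h2 b le_rfl⟩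

theorem IsNoncrossingRep.le_of_apply_eq (h : IsNoncrossingRep (Finset.Ico a (b + 1)) f)
    (hm : f b = m) {i : ℕ} (hi : m ≤ i) (hib : i < b) : m ≤ f i :=
  hm ▸ h.nested b i (hm ▸ hi) hib.le

theorem restrictIco_glueAt_left (hf : IsNoncrossingRep (Finset.Ico a m) f) (hmb : m < b) :
    restrictIco (glueAt m b f g) a m = f := by
  rw [isNoncrossingRep_Ico_iff] at hf
  obtain ⟨f1, f2, -⟩ := hf
  ext i
  unfold restrictIco glueAt
  grind

theorem restrictIco_glueAt_right {c : ℕ} (hc : m ≤ c)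
    (hg : IsNoncrossingRep (Finset.Ico c b) g) :
    restrictIco (glueAt m b f g) c b = g := by
  rw [isNoncrossingRep_Ico_iff] at hg
  obtain ⟨g1, g2, -⟩ := hg
  ext i
  unfold restrictIco glueAt
  grind

theorem glueAt_restrictIco {c : ℕ} (h : IsNoncrossingRep (Finset.Ico a (b + 1)) f)
    (hm : f b = m) (hc : ∀ i, m ≤ i → i < c → f i = i) :
    glueAt m b (restrictIco f a m) (restrictIco f c b) = f := by
  rw [isNoncrossingRep_Ico_iff] at h
  obtain ⟨f1, f2, -⟩ := h
  ext i
  unfold restrictIco glueAt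
  grind

theorem card_fixed_glueAt (ham : a ≤ m) (hmb : m < b) :
    #{i ∈ Finset.Ico a (b + 1) | glueAt m b f g i = i} =
      #{i ∈ Finset.Ico a m | f i = i} + #{i ∈ Finset.Ico m b | g i = i} := by
  rw [← Finset.card_union_of_disjoint]
  · congr 1
    ext i
    simp only [Finset.mem_filter, Finset.mem_Ico, Finset.mem_union, glueAt]
    grind
  · rw [Finset.disjoint_left]
    intro i
    simp only [Finset.mem_filter, Finset.mem_Ico]
    omega

end Glue

section Recurrence

variable {a b m : ℕ}

theorem repPoly_Ico_self (Q : (ℕ → ℕ) → Prop) (hQ : Q id) (a : ℕ) :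
    repPoly Q (Finset.Ico a a) = 1 := by
  classical
  have h : (noncrossingReps (Finset.Ico a a)).filter Q = {id} := by
    ext f
    rw [Finset.mem_filter, mem_noncrossingReps, Finset.mem_singleton]
    constructor
    · rintro ⟨h, -⟩
      ext i
      exact h.out i (by simp)
    · rintro rfl
      exact ⟨⟨fun _ _ => rfl, fun _ => id, fun _ => le_rfl, fun _ _ h _ => h⟩, hQ⟩
  rw [repPoly, h]
  simp

open scoped Classical in
/-- The part of `repPoly Q [a, b]` coming from the functions sending `b` to `m`. -/
noncomputable def repPolyLast (Q : (ℕ → ℕ) → Prop) (a b m : ℕ) : ℤ[X] :=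
  ∑ f ∈ noncrossingReps (Finset.Ico a (b + 1)) with Q f ∧ f b = m,
    X ^ #{i ∈ Finset.Ico a (b + 1) | f i = i}

theorem repPoly_Ico_succ (Q : (ℕ → ℕ) → Prop) (hab : a ≤ b) :
    repPoly Q (Finset.Ico a (b + 1)) =
      X * repPoly Q (Finset.Ico a b) + ∑ m ∈ Finset.Ico a b, repPolyLast Q a b m := by
  classical
  have hmaps : ∀ f ∈ (noncrossingReps (Finset.Ico a (b + 1))).filter Q,
      f b ∈ Finset.Ico a (b + 1) := by
    intro f hf
    rw [Finset.mem_filter, mem_noncrossingReps] at hf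
    exact hf.1.mem b (by simp [hab])
  rw [repPoly, ← Finset.sum_fiberwise_of_maps_to hmaps, Finset.sum_Ico_succ_top hab, add_comm]
  refine congrArg₂ (· + ·) ?_ ?_
  · rw [repPoly, Finset.mul_sum]
    refine Finset.sum_congr ?_ ?_
    · ext f
      rw [Finset.filter_filter, Finset.mem_filter, Finset.mem_filter, mem_noncrossingReps,
        mem_noncrossingReps, isNoncrossingRep_Ico_iff_succ (b := b)]
      tauto
    · intro f hf
      rw [Finset.mem_filter, mem_noncrossingReps, isNoncrossingRep_Ico_iff_succ] at hf
      rw [← Finset.insert_Ico_right_eq_Ico_add_one hab, Finset.filter_insert, if_pos hf.1.2,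
        Finset.card_insert_of_notMem (by simp), pow_succ']
  · refine Finset.sum_congr rfl fun m _ => ?_
    rw [repPolyLast, Finset.filter_filter]

theorem repPolyLast_true (ham : a ≤ m) (hmb : m < b) :
    repPolyLast (fun _ => True) a b m =
      repPoly (fun _ => True) (Finset.Ico a m) * repPoly (fun _ => True) (Finset.Ico m b) := by
  classical
  rw [repPoly, repPoly, Finset.sum_mul_sum, ← Finset.sum_product', repPolyLast]
  simp only [true_and, Finset.filter_true]
  symm
  refine Finset.sum_nbij' (fun p => glueAt m b p.1 p.2)
    (fun f => (restrictIco f a m, restrictIco f m b)) ?_ ?_ ?_ ?_ ?_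
  · rintro ⟨f, g⟩ h
    simp only [Finset.mem_product, mem_noncrossingReps, Finset.mem_filter] at h ⊢
    exact ⟨h.1.glueAt h.2 ham hmb, if_pos rfl⟩
  · intro f h
    simp only [Finset.mem_product, mem_noncrossingReps, Finset.mem_filter] at h ⊢
    exact ⟨h.1.restrictIco fun i hi _ => (isNoncrossingRep_Ico_iff.1 h.1).2.2.1 i hi,
      h.1.restrictIco fun i hi hib => h.1.le_of_apply_eq h.2 hi hib⟩
  · rintro ⟨f, g⟩ h
    simp only [Finset.mem_product, mem_noncrossingReps] at h
    simp only [restrictIco_glueAt_left h.1 hmb, restrictIco_glueAt_right le_rfl h.2]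
  · intro f h
    simp only [mem_noncrossingReps, Finset.mem_filter] at h
    exact glueAt_restrictIco h.1 h.2 (by omega)
  · rintro ⟨f, g⟩ _
    rw [card_fixed_glueAt ham hmb, pow_add]

theorem IsNoncrossingRep.mono_Ico {c : ℕ} {g : ℕ → ℕ} (hg : IsNoncrossingRep (Finset.Ico c b) g)
    (hmc : m ≤ c) : IsNoncrossingRep (Finset.Ico m b) g := by
  rw [isNoncrossingRep_Ico_iff] at *
  obtain ⟨g1, g2, g3, g4, g5⟩ := hg
  refine ⟨fun i hi => g1 i (by omega), g2, fun i hi => ?_, g4, g5⟩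
  by_cases hic : i < c
  · rwa [g1 i hic]
  · exact hmc.trans (g3 i (by omega))

theorem IsMatchingRep.restrictIco {f : ℕ → ℕ} (h : IsMatchingRep f) (c d : ℕ) :
    IsMatchingRep (restrictIco f c d) := by
  intro i j
  have := h i j
  unfold _root_.restrictIco
  grind

theorem IsMatchingRep.glueAt {f g : ℕ → ℕ} (hf : IsNoncrossingRep (Finset.Ico a m) f)
    (hg : IsNoncrossingRep (Finset.Ico (m + 1) b) g) (hf' : IsMatchingRep f)
    (hg' : IsMatchingRep g) : IsMatchingRep (glueAt m b f g) := by
  rw [isNoncrossingRep_Ico_iff] at hf hg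
  obtain ⟨f1, f2, f3, f4, f5⟩ := hf
  obtain ⟨g1, g2, g3, g4, g5⟩ := hg
  intro i j
  have := hf' i j
  have := hg' i j
  have := f4 i
  have := f4 j
  have := g1 i
  have := g1 j
  have := g3 i
  have := g3 j
  unfold _root_.glueAt
  split_ifs <;> omega

theorem repPolyLast_isMatchingRep (ham : a ≤ m) (hmb : m < b) :
    repPolyLast IsMatchingRep a b m =
      X * (repPoly IsMatchingRep (Finset.Ico a m) *
        repPoly IsMatchingRep (Finset.Ico (m + 1) b)) := by
  classical
  have hlast : ∀ f, IsNoncrossingRep (Finset.Ico a (b + 1)) f → IsMatchingRep f → f b = m →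
      f m = m ∧ ∀ i, m + 1 ≤ i → i < b → m + 1 ≤ f i := by
    intro f h hQ hm
    have hfm : f m = m := le_antisymm (h.le m) (h.le_of_apply_eq hm le_rfl hmb)
    refine ⟨hfm, fun i hi hib => ?_⟩
    have h1 := h.le_of_apply_eq hm (by omega : m ≤ i) hib
    have h2 := hQ i b
    omega
  rw [repPoly, repPoly, Finset.sum_mul_sum, ← Finset.sum_product', repPolyLast, Finset.mul_sum]
  symm
  refine Finset.sum_nbij' (fun p => glueAt m b p.1 p.2)
    (fun f => (restrictIco f a m, restrictIco f (m + 1) b)) ?_ ?_ ?_ ?_ ?_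
  · rintro ⟨f, g⟩ h
    simp only [Finset.mem_product, mem_noncrossingReps, Finset.mem_filter] at h ⊢
    exact ⟨h.1.1.glueAt (h.2.1.mono_Ico (Nat.le_succ m)) ham hmb,
      IsMatchingRep.glueAt h.1.1 h.2.1 h.1.2 h.2.2, if_pos rfl⟩
  · intro f h
    simp only [Finset.mem_product, mem_noncrossingReps, Finset.mem_filter] at h ⊢
    exact ⟨⟨h.1.restrictIco fun i hi _ => (isNoncrossingRep_Ico_iff.1 h.1).2.2.1 i hi,
      h.2.1.restrictIco a m⟩, h.1.restrictIco (hlast f h.1 h.2.1 h.2.2).2,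
      h.2.1.restrictIco _ b⟩
  · rintro ⟨f, g⟩ h
    simp only [Finset.mem_product, mem_noncrossingReps, Finset.mem_filter] at h
    simp only [restrictIco_glueAt_left h.1.1 hmb, restrictIco_glueAt_right (Nat.le_succ m) h.2.1]
  · intro f h
    simp only [mem_noncrossingReps, Finset.mem_filter] at h
    refine glueAt_restrictIco h.1 h.2.2 fun i hi hi' => ?_
    obtain rfl : i = m := by omega
    exact (hlast f h.1 h.2.1 h.2.2).1
  · rintro ⟨f, g⟩ h
    simp only [Finset.mem_product, mem_noncrossingReps, Finset.mem_filter] at h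
    rw [card_fixed_glueAt ham hmb, ← Finset.insert_Ico_add_one_left_eq_Ico hmb,
      Finset.filter_insert, if_pos ((isNoncrossingRep_Ico_iff.1 h.2.1).1 m (Nat.lt_succ_self m)),
      Finset.card_insert_of_notMem (by simp)]
    ring

theorem repPoly_true_Ico_succ (a b : ℕ) (hab : a ≤ b) :
    repPoly (fun _ => True) (Finset.Ico a (b + 1)) =
      X * repPoly (fun _ => True) (Finset.Ico a b) +
        ∑ m ∈ Finset.Ico a b, repPoly (fun _ => True) (Finset.Ico a m) *
          repPoly (fun _ => True) (Finset.Ico m b) := by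
  rw [repPoly_Ico_succ _ hab]
  refine congrArg _ (Finset.sum_congr rfl fun m hm => ?_)
  rw [Finset.mem_Ico] at hm
  exact repPolyLast_true hm.1 hm.2

theorem repPoly_isMatchingRep_Ico_succ (a b : ℕ) (hab : a ≤ b) :
    repPoly IsMatchingRep (Finset.Ico a (b + 1)) =
      X * repPoly IsMatchingRep (Finset.Ico a b) +
        X * ∑ m ∈ Finset.Ico a b, repPoly IsMatchingRep (Finset.Ico a m) *
          repPoly IsMatchingRep (Finset.Ico (m + 1) b) := by
  rw [repPoly_Ico_succ _ hab, Finset.mul_sum]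
  refine congrArg _ (Finset.sum_congr rfl fun m hm => ?_)
  rw [Finset.mem_Ico] at hm
  exact repPolyLast_isMatchingRep hm.1 hm.2

end Recurrence

/-- Upper Vandermonde convolution. -/
theorem sum_choose_mul_choose (N a b : ℕ) :
    ∑ p ∈ Finset.range (N + 1), p.choose a * (N - p).choose b = (N + 1).choose (a + b + 1) := by
  induction N generalizing b with
  | zero =>
    rcases a with _ | a <;> rcases b with _ | b <;> simp
    all_goals exact (Nat.choose_eq_zero_of_lt (by omega)).symm
  | succ N ih =>
    cases b with
    | zero =>
      simp only [Nat.choose_zero_right, mul_one, add_zero]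
      rw [← Nat.sum_Icc_choose, Finset.range_eq_Ico]
      symm
      apply Finset.sum_subset
      · intro x hx
        simp only [Finset.mem_Icc, Finset.mem_Ico] at *
        omega
      · intro x hx hx'
        simp only [Finset.mem_Icc, Finset.mem_Ico] at *
        exact Nat.choose_eq_zero_of_lt (by omega)
    | succ b =>
      rw [Finset.sum_range_succ, Nat.sub_self, Nat.choose_zero_succ, mul_zero, add_zero,
        Nat.choose_succ_succ' (N + 1), ← ih (b + 1), ← add_assoc, ← ih b,
        ← Finset.sum_add_distrib]
      refine Finset.sum_congr rfl fun p hp => ?_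
      rw [Finset.mem_range] at hp
      rw [show N + 1 - p = (N - p) + 1 by omega, Nat.choose_succ_succ, mul_add]

/-- The binomial transform of a sequence. -/
noncomputable def binomTransform (m : ℕ → ℤ[X]) (n : ℕ) : ℤ[X] :=
  ∑ i ∈ Finset.range (n + 1), C (n.choose i : ℤ) * m i

theorem binomTransform_eq_sum_range (m : ℕ → ℤ[X]) {n N : ℕ} (h : n ≤ N) :
    binomTransform m n = ∑ i ∈ Finset.range (N + 1), C (n.choose i : ℤ) * m i := by
  refine Finset.sum_subset (fun i hi => by simp only [Finset.mem_range] at *; omega) ?_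
  intro i _ hi
  rw [Finset.mem_range] at hi
  rw [Nat.choose_eq_zero_of_lt (by omega)]
  simp

theorem binomTransform_succ (m : ℕ → ℤ[X]) (n : ℕ) :
    binomTransform m (n + 1) = binomTransform m n + binomTransform (fun i => m (i + 1)) n := by
  rw [binomTransform_eq_sum_range m (Nat.le_succ n), binomTransform, binomTransform,
    Finset.sum_range_succ', Finset.sum_range_succ' _ (n + 1)]
  simp only [Nat.choose_succ_succ, Nat.cast_add, C_add, add_mul, Finset.sum_add_distrib,
    Nat.choose_zero_right]
  ring

theorem sum_binomTransform_mul (m : ℕ → ℤ[X]) (N : ℕ) :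
    ∑ p ∈ Finset.range (N + 1), binomTransform m p * binomTransform m (N - p) =
      ∑ i ∈ Finset.range (N + 1), C ((N + 1).choose (i + 1) : ℤ) *
        ∑ a ∈ Finset.range (i + 1), m a * m (i - a) := by
  have h1 : ∀ p ∈ Finset.range (N + 1), binomTransform m p * binomTransform m (N - p) =
      ∑ a ∈ Finset.range (N + 1), ∑ b ∈ Finset.range (N + 1),
        C ((p.choose a * (N - p).choose b : ℕ) : ℤ) * (m a * m b) := by
    intro p hp
    rw [Finset.mem_range] at hp
    rw [binomTransform_eq_sum_range m (by omega : p ≤ N),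
      binomTransform_eq_sum_range m (by omega : N - p ≤ N), Finset.sum_mul_sum]
    refine Finset.sum_congr rfl fun a _ => Finset.sum_congr rfl fun b _ => ?_
    push_cast [C_mul]
    ring
  have h2 : ∑ i ∈ Finset.range (N + 1), C ((N + 1).choose (i + 1) : ℤ) *
      ∑ a ∈ Finset.range (i + 1), m a * m (i - a) =
      ∑ a ∈ Finset.range (N + 1), ∑ i ∈ Finset.Ico a (N + 1),
        C ((N + 1).choose (i + 1) : ℤ) * (m a * m (i - a)) := by
    simp_rw [Finset.mul_sum]
    exact Finset.sum_comm' (by intro x y; simp only [Finset.mem_range, Finset.mem_Ico]; omega)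
  rw [Finset.sum_congr rfl h1, Finset.sum_comm, h2]
  refine Finset.sum_congr rfl fun a ha => ?_
  rw [Finset.sum_comm, Finset.sum_Ico_eq_sum_range]
  simp_rw [← Finset.sum_mul, ← map_sum, ← Nat.cast_sum, sum_choose_mul_choose]
  symm
  apply Finset.sum_subset_zero_on_sdiff
  · intro b hb
    simp only [Finset.mem_range] at *
    omega
  · intro b hb
    simp only [Finset.mem_sdiff, Finset.mem_range] at hb
    rw [Nat.choose_eq_zero_of_lt (by omega)]
    simp
  · intro b _
    rw [Nat.add_sub_cancel_left]

/-- The binomial transform of the Motzkin-type recurrence. -/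
theorem binomTransform_recurrence {m : ℕ → ℤ[X]} (t : ℤ[X])
    (h : ∀ n, m (n + 1) = t * m n + t * ∑ k ∈ Finset.range n, m k * m (n - 1 - k)) (n : ℕ) :
    binomTransform m (n + 1) = binomTransform m n + t * binomTransform m n +
      t * ∑ k ∈ Finset.range n, binomTransform m k * binomTransform m (n - 1 - k) := by
  rw [binomTransform_succ, add_assoc]
  congr 1
  rcases n with _ | N
  · simp [binomTransform, h]
  · simp only [Nat.add_sub_cancel]
    rw [sum_binomTransform_mul, binomTransform, binomTransform]
    simp only [h, mul_add, Finset.sum_add_distrib]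
    congr 1
    · rw [Finset.mul_sum]
      exact Finset.sum_congr rfl fun i _ => by ring
    · rw [Finset.sum_range_succ']
      simp only [Finset.range_zero, Finset.sum_empty, mul_zero, add_zero, Nat.add_sub_cancel]
      rw [Finset.mul_sum]
      refine Finset.sum_congr rfl fun i _ => ?_
      rw [mul_left_comm]

/-- An interval function satisfying the noncrossing recurrence equals `t` times the sequence
satisfying the transformed recurrence. -/
theorem interval_recurrence_eq_mul {c : ℕ → ℕ → ℤ[X]} {B : ℕ → ℤ[X]} (t : ℤ[X])
    (hc0 : ∀ a, c a a = 1)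
    (hc : ∀ a b, a ≤ b → c a (b + 1) = t * c a b + ∑ k ∈ Finset.Ico a b, c a k * c k b)
    (hB0 : B 0 = 1)
    (hB : ∀ n, B (n + 1) = B n + t * B n + t * ∑ k ∈ Finset.range n, B k * B (n - 1 - k))
    (n a : ℕ) : c a (a + n + 1) = t * B n := by
  induction n using Nat.strong_induction_on generalizing a with
  | _ n ih =>
    rw [hc a _ (by omega)]
    rcases n with _ | n
    · simp [hc0, hB0]
    · rw [Finset.sum_Ico_eq_sum_range, show a + (n + 1) - a = n + 1 by omega,
        Finset.sum_range_succ', hB, ← add_assoc a n 1]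
      have h1 : ∀ k ∈ Finset.range n,
          c a (a + (k + 1)) * c (a + (k + 1)) (a + n + 1) = t * B k * (t * B (n - 1 - k)) := by
        intro k hk
        rw [Finset.mem_range] at hk
        rw [← add_assoc, ih k (by omega), ← ih (n - 1 - k) (by omega) (a + k + 1)]
        congr 2
        omega
      rw [Finset.sum_congr rfl h1]
      simp only [add_zero, hc0, one_mul, ih n (Nat.lt_succ_self n), mul_add, Finset.mul_sum]
      rw [show ∑ k ∈ Finset.range n, t * B k * (t * B (n - 1 - k)) =
        ∑ k ∈ Finset.range n, t * (t * (B k * B (n - 1 - k))) from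
        Finset.sum_congr rfl fun k _ => by ring]
      ring

/-- An interval function satisfying the Motzkin-type recurrence depends only on the length. -/
theorem interval_recurrence_translate {c : ℕ → ℕ → ℤ[X]} (t : ℤ[X])
    (hc0 : ∀ a, c a a = 1)
    (hc : ∀ a b, a ≤ b →
      c a (b + 1) = t * c a b + t * ∑ k ∈ Finset.Ico a b, c a k * c (k + 1) b)
    (n a b : ℕ) : c a (a + n) = c b (b + n) := by
  induction n using Nat.strong_induction_on generalizing a b with
  | _ n ih =>
    rcases n with _ | n
    · simp [hc0]
    · rw [← add_assoc, ← add_assoc, hc _ _ (by omega), hc _ _ (by omega), ih n (by omega) a b,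
        Finset.sum_Ico_eq_sum_range, Finset.sum_Ico_eq_sum_range, Nat.add_sub_cancel_left,
        Nat.add_sub_cancel_left]
      congr 2
      refine Finset.sum_congr rfl fun k hk => ?_
      rw [Finset.mem_range] at hk
      have h := ih (n - 1 - k) (by omega) (a + k + 1) (b + k + 1)
      rw [show a + k + 1 + (n - 1 - k) = a + n by omega,
        show b + k + 1 + (n - 1 - k) = b + n by omega] at h
      rw [ih k (by omega) a b, h]

/-- For every `n ≥ 0`, in `ℤ[t]`:
`C_{n+1}(t) = t ⬝ ∑_{i=0}^n C(n,i) M_i(t)`, where `C_m(t)` sums `t^{#blocks}` over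
noncrossing partitions of `{1,…,m}` and `M_i(t)` sums `t^{#blocks}` over noncrossing
partial matchings of `{1,…,i}` (`M_0(t)=1`). -/
theorem stmt3 (n : ℕ) :
    partPoly (Finset.Icc 1 (n + 1)) (fun P => ¬ HasKCrossing P 2) =
      X * ∑ i ∈ Finset.range (n + 1),
        (C (n.choose i : ℤ)) *
          partPoly (Finset.Icc 1 i)
            (fun P => ¬ HasKCrossing P 2 ∧ IsPartialMatching P) := by
  have hM : ∀ i, partPoly (Finset.Icc 1 i)
      (fun P => ¬ HasKCrossing P 2 ∧ IsPartialMatching P) =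
      repPoly IsMatchingRep (Finset.Ico 1 (1 + i)) := by
    intro i
    rw [partPoly_eq_repPoly _ IsMatchingRep fun P => and_congr_right' (isPartialMatching_iff P)]
    congr 1
    ext j
    simp only [Finset.mem_Icc, Finset.mem_Ico]
    omega
  have hC : Finset.Icc 1 (n + 1) = Finset.Ico 1 (1 + n + 1) := by
    ext j
    simp only [Finset.mem_Icc, Finset.mem_Ico]
    omega
  rw [partPoly_eq_repPoly _ (fun _ => True) fun P => (and_iff_left trivial).symm, hC]
  simp only [hM]
  have hM0 : ∀ a, repPoly IsMatchingRep (Finset.Ico a a) = 1 :=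
    repPoly_Ico_self _ fun _ _ h _ _ => h
  refine interval_recurrence_eq_mul (c := fun a b => repPoly (fun _ => True) (Finset.Ico a b))
    (B := binomTransform fun i => repPoly IsMatchingRep (Finset.Ico 1 (1 + i))) X
    (repPoly_Ico_self _ trivial) repPoly_true_Ico_succ (by simpa [binomTransform] using hM0 1) ?_ n 1
  refine binomTransform_recurrence X fun k => ?_
  rw [← add_assoc, repPoly_isMatchingRep_Ico_succ _ _ (by omega), Finset.sum_Ico_eq_sum_range,
    Nat.add_sub_cancel_left]
  refine congrArg _ (congrArg _ (Finset.sum_congr rfl fun j hj => congrArg _ ?_))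
  rw [Finset.mem_range] at hj
  have h := interval_recurrence_translate
    (c := fun a b => repPoly IsMatchingRep (Finset.Ico a b)) X hM0
    repPoly_isMatchingRep_Ico_succ (k - 1 - j) (1 + j + 1) 1
  rwa [show 1 + j + 1 + (k - 1 - j) = 1 + k by omega] at h
end

section
/- For every integer n ≥ 0, the gamma-expansion of the Narayana polynomial holds: C_{n+1}(t) = t · Σ_{i=0}^{⌊n/2⌋} C(n,2i) · C_i · t^i · (1+t)^{n−2i} in ℤ[t], where C_{n+1}(t) = Σ_{k=1}^{n+1} (1/(n+1))·C(n+1,k)·C(n+1,k−1)·t^k is the (n+1)-st Narayana polynomial and C_i is the i-th Catalan number. -/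
open Polynomial

/-- The `m`-th Narayana polynomial `C_m(t) = ∑_{k=1}^m (1/m) C(m,k) C(m,k-1) t^k`
(as a polynomial with rational coefficients; its coefficients are in fact integers). -/
noncomputable def narayanaPoly (m : ℕ) : Polynomial ℚ :=
  ∑ k ∈ Finset.Icc 1 m, C ((1 / m : ℚ) * m.choose k * m.choose (k - 1)) * X ^ k

open Nat in
theorem catalan_eq_factorial_div (i : ℕ) :
    (catalan i : ℚ) = (2 * i)! / (i ! * (i + 1)!) := by
  have h : ((i + 1 : ℕ) : ℚ) * catalan i = (i + i)! / (i ! * i !) := by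
    rw [← Nat.cast_add_choose, ← two_mul, ← Nat.centralBinom_eq_two_mul_choose,
      ← succ_mul_catalan_eq_centralBinom]
    push_cast
    ring
  have hi : ((i + 1 : ℕ) : ℚ) ≠ 0 := by positivity
  rw [eq_div_iff (by positivity)] at h ⊢
  rw [two_mul, Nat.factorial_succ, ← h]
  push_cast
  ring

open Nat in
theorem choose_mul_catalan_mul_choose (i a b : ℕ) :
    ((2 * i + a + b).choose (2 * i) * catalan i * (a + b).choose a : ℚ) =
      (1 / (2 * i + a + b + 1 : ℕ) : ℚ) * (2 * i + a + b + 1).choose (i + a) *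
        ((i + a).choose i * (i + b + 1).choose b) := by
  rw [catalan_eq_factorial_div, show 2 * i + a + b + 1 = (i + a) + (i + b + 1) by ring,
    show i + b + 1 = b + (i + 1) by ring, Nat.cast_add_choose, Nat.cast_add_choose,
    Nat.cast_add_choose, Nat.cast_add_choose, show 2 * i + a + b = 2 * i + (a + b) by ring,
    Nat.cast_add_choose, show i + a + (b + (i + 1)) = 2 * i + (a + b) + 1 by ring,
    Nat.factorial_succ (2 * i + (a + b))]
  push_cast
  field_simp

theorem sum_choose_mul_catalan_mul_choose (k l : ℕ) :
    (∑ i ∈ Finset.range ((k + l) / 2 + 1), if i ≤ k then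
      ((k + l).choose (2 * i) * catalan i * (k + l - 2 * i).choose (k - i) : ℚ) else 0) =
      (1 / (k + l + 1 : ℕ) : ℚ) * (k + l + 1).choose (k + 1) * (k + l + 1).choose k := by
  have hsymm : (k + l + 1).choose (k + 1) = (k + (l + 1)).choose l :=
    (Nat.choose_symm_of_eq_add (by ring)).trans rfl
  rw [hsymm, Nat.add_choose_eq, Finset.Nat.sum_antidiagonal_eq_sum_range_succ
    (fun i j => k.choose i * (l + 1).choose j), mul_right_comm, Nat.cast_sum, Finset.mul_sum]
  have hleft : Finset.range (min k l + 1) ⊆ Finset.range ((k + l) / 2 + 1) :=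
    Finset.range_subset_range.2 (by omega)
  have hright : Finset.range (min k l + 1) ⊆ Finset.range (l + 1) :=
    Finset.range_subset_range.2 (by omega)
  rw [← Finset.sum_subset hleft, ← Finset.sum_subset hright]
  · refine Finset.sum_congr rfl fun i hi => ?_
    rw [Finset.mem_range] at hi
    obtain ⟨a, rfl⟩ := Nat.exists_eq_add_of_le (show i ≤ k by omega)
    obtain ⟨b, rfl⟩ := Nat.exists_eq_add_of_le (show i ≤ l by omega)
    rw [if_pos (by omega), show i + a + (i + b) = 2 * i + a + b by ring,
      show 2 * i + a + b - 2 * i = a + b by omega, Nat.add_sub_cancel_left,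
      Nat.add_sub_cancel_left, choose_mul_catalan_mul_choose, Nat.cast_mul]
  · intro i hi hi'
    rw [Finset.mem_range] at hi hi'
    rw [Nat.choose_eq_zero_of_lt (show k < i by omega)]
    simp
  · intro i hi hi'
    rw [Finset.mem_range] at hi hi'
    split_ifs
    · rw [Nat.choose_eq_zero_of_lt (show k + l - 2 * i < k - i by omega)]
      simp
    · rfl

theorem coeff_narayanaPoly (m k : ℕ) :
    (narayanaPoly m).coeff k =
      if k ∈ Finset.Icc 1 m then (1 / m : ℚ) * m.choose k * m.choose (k - 1) else 0 := by
  simp only [narayanaPoly, finsetSum_coeff, coeff_C_mul_X_pow, Finset.sum_ite_eq]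

/-- The gamma-expansion of the Narayana polynomial: for every `n ≥ 0`,
`C_{n+1}(t) = t ⬝ ∑_{i=0}^{⌊n/2⌋} C(n,2i) ⬝ Catalan(i) ⬝ t^i (1+t)^{n-2i}`. -/
theorem stmt5 (n : ℕ) :
    narayanaPoly (n + 1) =
      X * ∑ i ∈ Finset.range (n / 2 + 1),
        C ((n.choose (2 * i) * catalan i : ℕ) : ℚ) * X ^ i * (1 + X) ^ (n - 2 * i) := by
  ext (_ | k)
  · simp [coeff_narayanaPoly]
  rw [coeff_narayanaPoly, coeff_X_mul, finsetSum_coeff]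
  simp only [mul_assoc, coeff_C_mul, coeff_X_pow_mul', coeff_one_add_X_pow]
  by_cases hk : k ≤ n
  · obtain ⟨l, rfl⟩ := Nat.exists_eq_add_of_le hk
    rw [if_pos (by simp), ← mul_assoc, Nat.add_sub_cancel, ← sum_choose_mul_catalan_mul_choose]
    simp only [mul_ite, mul_zero, Nat.cast_mul]
  · rw [if_neg (by simp; omega), Finset.sum_eq_zero]
    intro i hi
    rw [Finset.mem_range] at hi
    rw [if_pos (by omega), Nat.choose_eq_zero_of_lt (show n - 2 * i < k - i by omega)]
    simp
end

section
/- For every integer n ≥ 1, the generating polynomial of noncrossing partitions of {1,…,n} by number of blocks equals the n-th Narayana polynomial: Σ_{P noncrossing partition of {1,…,n}} t^{(number of blocks of P)} = Σ_{k=1}^{n} (1/n)·C(n,k)·C(n,k−1)·t^k. -/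
open Finset Polynomial

open scoped Classical in
/-- `∑ t^{#blocks}` over partitions of `s` satisfying `pr`, with rational coefficients. -/
noncomputable def partPolyQ (s : Finset ℕ) (pr : Finpartition s → Prop) : Polynomial ℚ :=
  ∑ P : Finpartition s, if pr P then (X : Polynomial ℚ) ^ P.parts.card else 0

/-- The arcs of `P` have no crossing. -/
def IsNoncrossing {s : Finset ℕ} (P : Finpartition s) : Prop :=
  ∀ i₁ j₁ i₂ j₂, IsArc P i₁ j₁ → IsArc P i₂ j₂ → ¬(i₁ < i₂ ∧ i₂ < j₁ ∧ j₁ < j₂)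

theorem not_hasKCrossing_two_iff_s6 {s : Finset ℕ} (P : Finpartition s) :
    ¬ HasKCrossing P 2 ↔ IsNoncrossing P := by
  constructor
  · rintro h i₁ j₁ i₂ j₂ h₁ h₂ ⟨hi, hij, hj⟩
    refine h ⟨![i₁, i₂], ![j₁, j₂], ?_, ?_, ?_, ?_⟩
    · simpa [Fin.strictMono_iff_lt_succ] using hi
    · simpa [Fin.strictMono_iff_lt_succ] using hj
    · simp only [Fin.forall_fin_two]
      exact ⟨Or.inl h₁, Or.inl h₂⟩
    · simp only [Fin.forall_fin_two, Matrix.cons_val_zero, Matrix.cons_val_one]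
      omega
  · rintro h ⟨f, g, hf, hg, hfg, hlt⟩
    have hf' : f 0 < f 1 := hf (by decide)
    have hg' : g 0 < g 1 := hg (by decide)
    have arc (m : Fin 2) : IsArc P (f m) (g m) :=
      (hfg m).resolve_right fun h => (hlt m m).ne h.1
    exact h _ _ _ _ (arc 0) (arc 1) ⟨hf', hlt 1 0, hg'⟩

theorem IsArc.right_mem {s : Finset ℕ} {P : Finpartition s} {i j : ℕ} (h : IsArc P i j) :
    j ∈ s := by
  obtain ⟨-, B, hB, -, hj, -⟩ := h
  exact P.le hB hj

/-- An element that is not the largest of its block is the left end of an arc. -/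
theorem exists_isArc_of_lt {s : Finset ℕ} {P : Finpartition s} {B : Finset ℕ} (hB : B ∈ P.parts)
    {b c : ℕ} (hb : b ∈ B) (hc : c ∈ B) (hbc : b < c) : ∃ j, IsArc P b j := by
  have hne : (B.filter (b < ·)).Nonempty := ⟨c, by simp [hc, hbc]⟩
  have hmin := Finset.min'_mem _ hne
  rw [Finset.mem_filter] at hmin
  refine ⟨_, hmin.2, B, hB, hb, hmin.1, fun l hl hlt => ?_⟩
  exact (Finset.min'_le _ l (by simp [hl, hlt.1])).not_gt hlt.2

open scoped Classical in
/-- The elements under no arc and at the left end of no arc: those to which a new largest element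
can be joined without creating a crossing. -/
noncomputable def visible {s : Finset ℕ} (P : Finpartition s) : Finset ℕ :=
  s.filter fun b => ∀ i j, IsArc P i j → ¬(i ≤ b ∧ b < j)

theorem mem_visible {s : Finset ℕ} {P : Finpartition s} {b : ℕ} :
    b ∈ visible P ↔ b ∈ s ∧ ∀ i j, IsArc P i j → ¬(i ≤ b ∧ b < j) := by
  classical exact Finset.mem_filter

section Adjoin

variable {s : Finset ℕ} {a : ℕ}

/-- Adjoin a new element `a` to the block `C` of `P`, or as a singleton block if `C = ∅`. -/
def adjoin (ha : a ∉ s) (P : Finpartition s) (C : Finset ℕ) (hC : C ∈ insert ∅ P.parts) :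
    Finpartition (insert a s) where
  parts := insert (insert a C) (P.parts.erase C)
  supIndep := by
    rw [Finset.supIndep_iff_pairwiseDisjoint]
    have hdisj : ∀ D ∈ P.parts.erase C, Disjoint (insert a C) D := by
      intro D hD
      rw [Finset.mem_erase] at hD
      rw [Finset.disjoint_insert_left]
      refine ⟨fun h => ha (P.le hD.2 h), ?_⟩
      rcases Finset.mem_insert.1 hC with rfl | hC
      · simp
      · exact P.disjoint hC hD.2 hD.1.symm
    rw [Finset.coe_insert]
    refine Set.PairwiseDisjoint.insert (P.disjoint.subset (by simp)) ?_
    intro D hD _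
    exact hdisj D hD
  sup_parts := by
    ext x
    have hx : x ∈ s ↔ ∃ B ∈ P.parts, x ∈ B :=
      ⟨fun h => P.exists_mem h, fun ⟨_, hB, h⟩ => P.le hB h⟩
    have hC' : C = ∅ ∨ C ∈ P.parts := by simpa using hC
    simp only [Finset.mem_sup, Finset.mem_insert, Finset.mem_erase, id, hx]
    constructor
    · rintro ⟨B, rfl | ⟨-, hB⟩, hxB⟩
      · rcases Finset.mem_insert.1 hxB with h | h
        · exact Or.inl h
        · rcases hC' with rfl | hC'
          · simp at h
          · exact Or.inr ⟨C, hC', h⟩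
      · exact Or.inr ⟨B, hB, hxB⟩
    · rintro (rfl | ⟨B, hB, hxB⟩)
      · exact ⟨_, Or.inl rfl, by simp⟩
      · by_cases h : B = C
        · exact ⟨_, Or.inl rfl, by simp [← h, hxB]⟩
        · exact ⟨B, Or.inr ⟨h, hB⟩, hxB⟩
  bot_notMem := by
    simp only [Finset.bot_eq_empty, Finset.mem_insert, Finset.mem_erase, not_or, not_and]
    exact ⟨(Finset.insert_ne_empty _ _).symm, fun _ => P.bot_notMem⟩

theorem insert_notMem_parts (ha : a ∉ s) (P : Finpartition s) (C : Finset ℕ) :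
    insert a C ∉ P.parts :=
  fun h => ha (P.le h (Finset.mem_insert_self a C))

theorem card_parts_adjoin_empty (ha : a ∉ s) (P : Finpartition s) (hC : ∅ ∈ insert ∅ P.parts) :
    (adjoin ha P ∅ hC).parts.card = P.parts.card + 1 := by
  have h : (∅ : Finset ℕ) ∉ P.parts := P.bot_notMem
  change (insert (insert a ∅) (P.parts.erase ∅)).card = _
  rw [Finset.erase_eq_of_notMem h, Finset.card_insert_of_notMem (insert_notMem_parts ha P ∅)]

theorem card_parts_adjoin (ha : a ∉ s) (P : Finpartition s) {C : Finset ℕ}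
    (hC : C ∈ insert ∅ P.parts) (hCP : C ∈ P.parts) :
    (adjoin ha P C hC).parts.card = P.parts.card := by
  have h : insert a C ∉ P.parts.erase C :=
    fun h => insert_notMem_parts ha P C (Finset.mem_of_mem_erase h)
  rw [adjoin, Finset.card_insert_of_notMem h, Finset.card_erase_add_one hCP]

theorem sum_finpartition_insert {M : Type*} [AddCommMonoid M] (ha : a ∉ s)
    (F : Finpartition (insert a s) → M) :
    ∑ Q, F Q = ∑ P : Finpartition s, ∑ C ∈ (insert ∅ P.parts).attach, F (adjoin ha P C C.2) := by
  rw [Finset.sum_sigma']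
  symm
  refine Finset.sum_bij (fun x _ => adjoin ha x.1 x.2.1 x.2.2) (by simp) ?_ ?_ (by simp)
  · rintro ⟨P, C, hC⟩ - ⟨P', C', hC'⟩ - h
    have hparts : insert (insert a C) (P.parts.erase C) =
        insert (insert a C') (P'.parts.erase C') := congrArg Finpartition.parts h
    have notMem (P : Finpartition s) (C : Finset ℕ) (hC : C ∈ insert ∅ P.parts) : a ∉ C := by
      rcases Finset.mem_insert.1 hC with rfl | hC
      · simp
      · exact fun h => ha (P.le hC h)
    have hCC : C = C' := by
      have h1 : insert a C ∈ insert (insert a C') (P'.parts.erase C') := by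
        rw [← hparts]; simp
      rcases Finset.mem_insert.1 h1 with h1 | h1
      · rw [← Finset.erase_insert (notMem P C hC), h1, Finset.erase_insert (notMem P' C' hC')]
      · exact absurd (Finset.mem_of_mem_erase h1) (insert_notMem_parts ha P' C)
    subst hCC
    have hPP : P.parts.erase C = P'.parts.erase C := by
      have key (P : Finpartition s) : insert a C ∉ P.parts.erase C :=
        fun h => insert_notMem_parts ha P C (Finset.mem_of_mem_erase h)
      rw [← Finset.erase_insert (key P), hparts, Finset.erase_insert (key P')]
    have hP : P = P' := by
      have key (P : Finpartition s) (hC : C ∈ insert ∅ P.parts) :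
          P.parts = (insert C (P.parts.erase C)).erase ∅ := by
        have h0 : (∅ : Finset ℕ) ∉ P.parts := P.bot_notMem
        rcases Finset.mem_insert.1 hC with rfl | hC
        · simp [h0]
        · rw [Finset.insert_erase hC, Finset.erase_eq_of_notMem h0]
      ext1
      rw [key P hC, key P' hC', hPP]
    subst hP
    rfl
  · intro Q _
    have haQ : a ∈ insert a s := by simp
    set D := Q.part a
    have hDQ : D ∈ Q.parts := Q.part_mem.2 haQ
    have haD : a ∈ D := Q.mem_part haQ
    have hnot (B : Finset ℕ) (hB : B ∈ Q.parts) (h : B ≠ D) : a ∉ B := fun haB =>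
      h (Q.eq_of_mem_parts hB hDQ haB haD)
    have hQ0 : (∅ : Finset ℕ) ∉ Q.parts := Q.bot_notMem
    have hx (x : ℕ) : x ∈ insert a s ↔ ∃ B ∈ Q.parts, x ∈ B :=
      ⟨fun h => Q.exists_mem h, fun ⟨_, hB, h⟩ => Q.le hB h⟩
    let P : Finpartition s :=
      { parts := (insert (D.erase a) (Q.parts.erase D)).erase ∅
        supIndep := by
          rw [Finset.supIndep_iff_pairwiseDisjoint]
          refine Set.PairwiseDisjoint.subset
            (t := insert (D.erase a) (Q.parts.erase D : Set (Finset ℕ))) ?_ ?_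
          · refine Set.PairwiseDisjoint.insert (Q.disjoint.subset (by simp)) ?_
            intro B hB _
            rw [Finset.mem_coe, Finset.mem_erase] at hB
            exact (Q.disjoint hDQ hB.2 hB.1.symm).mono_left (Finset.erase_subset _ _)
          · intro B hB
            simpa [and_comm] using Finset.mem_of_mem_erase hB
        sup_parts := by
          ext x
          simp only [Finset.mem_sup, Finset.mem_insert, Finset.mem_erase, id]
          constructor
          · rintro ⟨B, ⟨-, rfl | ⟨hBD, hB⟩⟩, hxB⟩
            · rw [Finset.mem_erase] at hxB
              exact (Finset.mem_insert.1 ((hx x).2 ⟨D, hDQ, hxB.2⟩)).resolve_left hxB.1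
            · refine (Finset.mem_insert.1 ((hx x).2 ⟨B, hB, hxB⟩)).resolve_left ?_
              rintro rfl
              exact hnot B hB hBD hxB
          · intro hxs
            have hxa : x ≠ a := fun h => ha (h ▸ hxs)
            obtain ⟨B, hB, hxB⟩ := (hx x).1 (Finset.mem_insert_of_mem hxs)
            by_cases hBD : B = D
            · have hxe : x ∈ D.erase a := Finset.mem_erase.2 ⟨hxa, hBD ▸ hxB⟩
              exact ⟨D.erase a, ⟨Finset.ne_empty_of_mem hxe, Or.inl rfl⟩, hxe⟩
            · exact ⟨B, ⟨Finset.ne_empty_of_mem hxB, Or.inr ⟨hBD, hB⟩⟩, hxB⟩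
        bot_notMem := by simp }
    have hC : D.erase a ∈ insert ∅ P.parts := by
      rw [Finset.mem_insert]
      refine or_iff_not_imp_left.2 fun h => ?_
      change D.erase a ∈ (insert (D.erase a) (Q.parts.erase D)).erase ∅
      exact Finset.mem_erase.2 ⟨h, Finset.mem_insert_self _ _⟩
    refine ⟨⟨P, D.erase a, hC⟩,
      Finset.mem_sigma.2 ⟨Finset.mem_univ _, Finset.mem_attach _ _⟩, ?_⟩
    ext1
    change insert (insert a (D.erase a))
      (((insert (D.erase a) (Q.parts.erase D)).erase ∅).erase (D.erase a)) = Q.parts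
    have hDe : D.erase a ∉ Q.parts.erase D := by
      intro h
      rw [Finset.mem_erase] at h
      obtain ⟨x, hxD⟩ := Q.nonempty_of_mem_parts h.2
      exact h.1 (Q.eq_of_mem_parts h.2 hDQ hxD (Finset.mem_of_mem_erase hxD))
    rw [Finset.erase_right_comm, Finset.erase_insert hDe, Finset.insert_erase haD,
      Finset.erase_eq_of_notMem (fun h => hQ0 (Finset.mem_of_mem_erase h)),
      Finset.insert_erase hDQ]

theorem isArc_adjoin (hlt : ∀ x ∈ s, x < a) (ha : a ∉ s) (P : Finpartition s)
    {C : Finset ℕ} (hC : C ∈ insert ∅ P.parts) {i j : ℕ} :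
    IsArc (adjoin ha P C hC) i j ↔ IsArc P i j ∨ (j = a ∧ i ∈ C ∧ ∀ l ∈ C, l ≤ i) := by
  have hCP {x : ℕ} (hx : x ∈ C) : C ∈ P.parts :=
    (Finset.mem_insert.1 hC).resolve_left (Finset.ne_empty_of_mem hx)
  have hCa {x : ℕ} (hx : x ∈ C) : x < a := hlt x (P.le (hCP hx) hx)
  constructor
  · rintro ⟨hij, B, hB, hi, hj, hl⟩
    rcases Finset.mem_insert.1 hB with rfl | hB
    · have hiC : i ∈ C := by
        rcases Finset.mem_insert.1 hi with rfl | hi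
        · rcases Finset.mem_insert.1 hj with rfl | hj
          · exact absurd hij (lt_irrefl _)
          · exact absurd hij (hCa hj).not_gt
        · exact hi
      rcases Finset.mem_insert.1 hj with rfl | hj
      · refine Or.inr ⟨rfl, hiC, fun l hlC => ?_⟩
        by_contra h
        exact hl l (Finset.mem_insert_of_mem hlC) ⟨not_le.1 h, hCa hlC⟩
      · exact Or.inl ⟨hij, C, hCP hj, hiC, hj, fun l hlC => hl l (Finset.mem_insert_of_mem hlC)⟩
    · exact Or.inl ⟨hij, B, Finset.mem_of_mem_erase hB, hi, hj, hl⟩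
  · rintro (⟨hij, B, hB, hi, hj, hl⟩ | ⟨rfl, hi, hmax⟩)
    · refine ⟨hij, ?_⟩
      by_cases hBC : B = C
      · subst hBC
        refine ⟨insert a B, Finset.mem_insert_self _ _, Finset.mem_insert_of_mem hi,
          Finset.mem_insert_of_mem hj, fun l hlB => ?_⟩
        rcases Finset.mem_insert.1 hlB with rfl | hlB
        · exact fun h => (hCa hj).not_gt h.2
        · exact hl l hlB
      · exact ⟨B, Finset.mem_insert_of_mem (Finset.mem_erase.2 ⟨hBC, hB⟩), hi, hj, hl⟩
    · refine ⟨hCa hi, insert j C, Finset.mem_insert_self _ _, Finset.mem_insert_of_mem hi,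
        Finset.mem_insert_self _ _, fun l hl => ?_⟩
      rcases Finset.mem_insert.1 hl with rfl | hl
      · exact fun h => lt_irrefl _ h.2
      · exact fun h => (hmax l hl).not_gt h.1

theorem isNoncrossing_adjoin (hlt : ∀ x ∈ s, x < a) (ha : a ∉ s) (P : Finpartition s)
    {C : Finset ℕ} (hC : C ∈ insert ∅ P.parts) :
    IsNoncrossing (adjoin ha P C hC) ↔
      IsNoncrossing P ∧ ∀ b ∈ C, (∀ l ∈ C, l ≤ b) → b ∈ visible P := by
  simp only [IsNoncrossing, isArc_adjoin hlt ha P hC]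
  constructor
  · intro h
    refine ⟨fun i₁ j₁ i₂ j₂ h₁ h₂ => h i₁ j₁ i₂ j₂ (Or.inl h₁) (Or.inl h₂), fun b hb hmax => ?_⟩
    have hCP : C ∈ P.parts :=
      (Finset.mem_insert.1 hC).resolve_left (Finset.ne_empty_of_mem hb)
    refine mem_visible.2 ⟨P.le hCP hb, ?_⟩
    rintro i j hij ⟨hib, hbj⟩
    rcases hib.eq_or_lt with rfl | hib
    · obtain ⟨-, B, hB, hi, hj, -⟩ := hij
      obtain rfl := P.eq_of_mem_parts hB hCP hi hb
      exact (hmax j hj).not_gt hbj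
    · exact h i j b a (Or.inl hij) (Or.inr ⟨rfl, hb, hmax⟩) ⟨hib, hbj, hlt j hij.right_mem⟩
  · rintro ⟨hP, hV⟩ i₁ j₁ i₂ j₂ (h₁ | ⟨rfl, -, -⟩) (h₂ | ⟨rfl, hi, hmax⟩) ⟨hi₁, hij, hj₁⟩
    · exact hP _ _ _ _ h₁ h₂ ⟨hi₁, hij, hj₁⟩
    · exact (mem_visible.1 (hV _ hi hmax)).2 _ _ h₁ ⟨hi₁.le, hij⟩
    · exact (hlt _ h₂.right_mem).not_gt hj₁
    · exact lt_irrefl _ hj₁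

theorem mem_visible_adjoin (hlt : ∀ x ∈ s, x < a) (ha : a ∉ s) (P : Finpartition s)
    {C : Finset ℕ} (hC : C ∈ insert ∅ P.parts) {x : ℕ} :
    x ∈ visible (adjoin ha P C hC) ↔
      x = a ∨ (x ∈ visible P ∧ ∀ b ∈ C, (∀ l ∈ C, l ≤ b) → x < b) := by
  simp only [mem_visible, isArc_adjoin hlt ha P hC, Finset.mem_insert]
  constructor
  · rintro ⟨rfl | hx, h⟩
    · exact Or.inl rfl
    · refine Or.inr ⟨⟨hx, fun i j hij => h i j (Or.inl hij)⟩, fun b hb hmax => ?_⟩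
      by_contra hxb
      exact h b a (Or.inr ⟨rfl, hb, hmax⟩) ⟨not_lt.1 hxb, hlt x hx⟩
  · rintro (rfl | ⟨⟨hx, h⟩, hb⟩)
    · refine ⟨Or.inl rfl, ?_⟩
      rintro i j (hij | ⟨rfl, -, -⟩) ⟨-, h⟩
      · exact (hlt j hij.right_mem).not_gt h
      · exact lt_irrefl _ h
    · refine ⟨Or.inr hx, ?_⟩
      rintro i j (hij | ⟨rfl, hi, hmax⟩)
      · exact h i j hij
      · exact fun h' => (hb i hi hmax).not_ge h'.1

end Adjoin

theorem sum_visible_sup {M : Type*} [AddCommMonoid M] {s : Finset ℕ} (P : Finpartition s)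
    (f : ℕ → M) :
    ∑ C ∈ P.parts with C.sup id ∈ visible P, f (C.sup id) = ∑ b ∈ visible P, f b := by
  have hsup {C : Finset ℕ} (hC : C ∈ P.parts) : C.sup id ∈ C := by
    obtain ⟨b, hb, h⟩ := Finset.exists_mem_eq_sup C (P.nonempty_of_mem_parts hC) id
    rw [h]
    exact hb
  refine Finset.sum_nbij (fun C => C.sup id) (fun C hC => (Finset.mem_filter.1 hC).2) ?_ ?_
    (fun _ _ => rfl)
  · intro B hB C hC h
    rw [Finset.mem_coe, Finset.mem_filter] at hB hC
    change B.sup id = C.sup id at h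
    exact P.eq_of_mem_parts hB.1 hC.1 (hsup hB.1) (by rw [h]; exact hsup hC.1)
  · intro b hb
    obtain ⟨hbs, hvis⟩ := mem_visible.1 hb
    obtain ⟨B, hB, hbB⟩ := P.exists_mem hbs
    have hBb : B.sup id = b := by
      refine le_antisymm (Finset.sup_le fun c hc => ?_) (Finset.le_sup (f := id) hbB)
      by_contra hbc
      obtain ⟨j, hj⟩ := exists_isArc_of_lt hB hbB hc (not_le.1 hbc)
      exact hvis b j hj ⟨le_rfl, hj.1⟩
    exact ⟨B, by simpa [hB, hBb] using hb, hBb⟩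

theorem sum_card_filter_lt {M : Type*} [AddCommMonoid M] (V : Finset ℕ) (f : ℕ → M) :
    ∑ b ∈ V, f (V.filter (· < b)).card = ∑ j ∈ Finset.range V.card, f j := by
  induction V using Finset.induction_on_max with
  | empty => simp
  | insert m V hm ih =>
    have hmV : m ∉ V := fun h => lt_irrefl _ (hm m h)
    have h1 : (insert m V).filter (· < m) = V := by
      rw [Finset.filter_insert, if_neg (lt_irrefl m), Finset.filter_true_of_mem hm]
    have h2 : ∀ b ∈ V, (insert m V).filter (· < b) = V.filter (· < b) := fun b hb => by
      rw [Finset.filter_insert, if_neg (hm b hb).not_gt]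
    rw [Finset.sum_insert hmV, Finset.card_insert_of_notMem hmV, Finset.sum_range_succ, h1,
      Finset.sum_congr rfl fun b hb => by rw [h2 b hb], ih, add_comm]

open scoped Classical in
/-- Every noncrossing partition of `insert a s`, where `a` exceeds all elements of `s`, arises
from one of `s` by making `a` a singleton or joining it to a visible element. -/
theorem sum_noncrossing_insert {M : Type*} [AddCommMonoid M] {s : Finset ℕ} {a : ℕ}
    (hlt : ∀ x ∈ s, x < a) (g : ℕ → ℕ → M) :
    (∑ Q : Finpartition (insert a s),
        if IsNoncrossing Q then g Q.parts.card (visible Q).card else 0) =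
      ∑ P : Finpartition s, if IsNoncrossing P then
        g (P.parts.card + 1) ((visible P).card + 1) +
          ∑ j ∈ Finset.range (visible P).card, g P.parts.card (j + 1) else 0 := by
  have ha : a ∉ s := fun h => lt_irrefl _ (hlt a h)
  rw [sum_finpartition_insert ha]
  refine Finset.sum_congr rfl fun P _ => ?_
  have haV (V : Finset ℕ) (hV : V ⊆ visible P) : a ∉ V :=
    fun h => ha (mem_visible.1 (hV h)).1
  have hvis_empty (h : ∅ ∈ insert ∅ P.parts) :
      (visible (adjoin ha P ∅ h)).card = (visible P).card + 1 := by
    rw [← Finset.card_insert_of_notMem (haV _ subset_rfl)]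
    congr 1
    ext x
    simp [mem_visible_adjoin hlt]
  have hmax {C : Finset ℕ} (hC : C ∈ P.parts) (b : ℕ) :
      (b ∈ C ∧ ∀ l ∈ C, l ≤ b) ↔ b = C.sup id := by
    constructor
    · rintro ⟨hb, h⟩
      exact le_antisymm (Finset.le_sup (f := id) hb) (Finset.sup_le h)
    · rintro rfl
      obtain ⟨b, hb, h⟩ := Finset.exists_mem_eq_sup C (P.nonempty_of_mem_parts hC) id
      exact ⟨by rw [h]; exact hb, fun l hl => Finset.le_sup (f := id) hl⟩
  have hforall {C : Finset ℕ} (hC : C ∈ P.parts) (p : ℕ → Prop) :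
      (∀ b ∈ C, (∀ l ∈ C, l ≤ b) → p b) ↔ p (C.sup id) :=
    ⟨fun h => h _ ((hmax hC _).2 rfl).1 ((hmax hC _).2 rfl).2,
      fun h b hb hb' => (hmax hC b).1 ⟨hb, hb'⟩ ▸ h⟩
  have hvis {C : Finset ℕ} (h : C ∈ insert ∅ P.parts) (hC : C ∈ P.parts) :
      (visible (adjoin ha P C h)).card = ((visible P).filter (· < C.sup id)).card + 1 := by
    rw [← Finset.card_insert_of_notMem (haV _ (Finset.filter_subset _ _))]
    congr 1
    ext x
    rw [mem_visible_adjoin hlt, hforall hC, Finset.mem_insert, Finset.mem_filter]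
  have h0 : (∅ : Finset ℕ) ∉ P.parts := P.bot_notMem
  let F (C : Finset ℕ) : M := if h : C ∈ insert ∅ P.parts then
    if IsNoncrossing (adjoin ha P C h) then
      g (adjoin ha P C h).parts.card (visible (adjoin ha P C h)).card else 0 else 0
  have hF : ∀ C ∈ (insert ∅ P.parts).attach,
      (if IsNoncrossing (adjoin ha P C C.2) then
        g (adjoin ha P C C.2).parts.card (visible (adjoin ha P C C.2)).card else 0) = F C :=
    fun C _ => by simp only [F, dif_pos C.2]
  rw [Finset.sum_congr rfl hF, Finset.sum_attach (insert ∅ P.parts) F, Finset.sum_insert h0]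
  have hF0 : F ∅ = if IsNoncrossing P then
      g (P.parts.card + 1) ((visible P).card + 1) else 0 := by
    have h : (∅ : Finset ℕ) ∈ insert ∅ P.parts := Finset.mem_insert_self _ _
    simp only [F, dif_pos h, card_parts_adjoin_empty, hvis_empty, isNoncrossing_adjoin hlt]
    simp
  have hFC : ∀ C ∈ P.parts, F C = if IsNoncrossing P then
      (if C.sup id ∈ visible P then
        g P.parts.card (((visible P).filter (· < C.sup id)).card + 1) else 0) else 0 := by
    intro C hC
    have h : C ∈ insert ∅ P.parts := Finset.mem_insert_of_mem hC
    simp only [F, dif_pos h, card_parts_adjoin ha P h hC, hvis h hC,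
      isNoncrossing_adjoin hlt, hforall hC, ite_and]
  rw [hF0, Finset.sum_congr rfl hFC]
  split_ifs
  · rw [← Finset.sum_filter,
      sum_visible_sup P fun b => g P.parts.card (((visible P).filter (· < b)).card + 1),
      sum_card_filter_lt (visible P) fun j => g P.parts.card (j + 1)]
  · simp

/-- The weight of all noncrossing extensions by `m` larger elements of a noncrossing partition
with `v` visible elements, each new block being weighted by `X`. -/
noncomputable def extensionPoly : ℕ → ℕ → ℚ[X]
  | 0, _ => 1
  | m + 1, v => X * extensionPoly m (v + 1) + ∑ j ∈ Finset.range v, extensionPoly m (j + 1)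

open scoped Classical in
theorem sum_noncrossing_Icc (n m : ℕ) :
    (∑ P : Finpartition (Finset.Icc 1 n),
        if IsNoncrossing P then X ^ P.parts.card * extensionPoly m (visible P).card else 0) =
      extensionPoly (n + m) 0 := by
  induction n generalizing m with
  | zero =>
    have hI : Finset.Icc 1 0 = (⊥ : Finset ℕ) := rfl
    rw [hI, Fintype.sum_unique]
    have hP : (default : Finpartition (⊥ : Finset ℕ)).parts = ∅ := rfl
    have hnc : IsNoncrossing (default : Finpartition (⊥ : Finset ℕ)) := by
      rintro i j _ _ ⟨-, B, hB, -⟩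
      simp [hP] at hB
    have hv : visible (default : Finpartition (⊥ : Finset ℕ)) = ∅ := by
      ext b
      simp [mem_visible]
    rw [if_pos hnc, hP, hv]
    simp
  | succ n ih =>
    have hI : Finset.Icc 1 (n + 1) = insert (n + 1) (Finset.Icc 1 n) := by
      ext x
      simp only [Finset.mem_Icc, Finset.mem_insert]
      omega
    rw [hI, sum_noncrossing_insert (fun x hx => Nat.lt_succ_of_le (Finset.mem_Icc.1 hx).2)
      fun k v => X ^ k * extensionPoly m v, show n + 1 + m = n + (m + 1) by omega, ← ih (m + 1)]
    refine Finset.sum_congr rfl fun P _ => ?_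
    rw [extensionPoly, mul_add, ← Finset.mul_sum, pow_succ, mul_assoc]

/-- The binomial coefficient `C(a, b)` with an integer lower argument, as a rational. -/
def intChoose (a : ℕ) (b : ℤ) : ℚ := if 0 ≤ b then a.choose b.toNat else 0

theorem intChoose_natCast (a b : ℕ) : intChoose a b = a.choose b := by
  simp [intChoose]

theorem intChoose_of_neg (a : ℕ) {b : ℤ} (hb : b < 0) : intChoose a b = 0 :=
  if_neg hb.not_ge

theorem intChoose_succ (a : ℕ) (b : ℤ) :
    intChoose (a + 1) b = intChoose a b + intChoose a (b - 1) := by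
  rcases lt_trichotomy b 0 with hb | rfl | hb
  · simp [intChoose_of_neg, hb, show b - 1 < 0 by omega]
  · simp [intChoose]
  · obtain ⟨c, rfl⟩ : ∃ c : ℕ, b = (c + 1 : ℕ) := ⟨(b - 1).toNat, by omega⟩
    rw [show ((c + 1 : ℕ) : ℤ) - 1 = c by simp, intChoose_natCast, intChoose_natCast,
      intChoose_natCast, Nat.choose_succ_succ]
    push_cast
    ring

theorem intChoose_symm (a : ℕ) (b : ℤ) : intChoose a (a - b) = intChoose a b := by
  rcases lt_or_ge b 0 with hb | hb
  · obtain ⟨c, hc⟩ : ∃ c : ℕ, (a : ℤ) - b = c := ⟨(a - b).toNat, by omega⟩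
    rw [intChoose_of_neg a hb, hc, intChoose_natCast, Nat.choose_eq_zero_of_lt (by omega),
      Nat.cast_zero]
  · lift b to ℕ using hb
    rcases le_or_gt b a with hba | hba
    · rw [← Nat.cast_sub hba, intChoose_natCast, intChoose_natCast, Nat.choose_symm hba]
    · rw [intChoose_of_neg a (by omega), intChoose_natCast, Nat.choose_eq_zero_of_lt hba,
        Nat.cast_zero]

/-- The coefficient of `X ^ k` in `extensionPoly m (v + 1)`. -/
def extensionCoeff (m v : ℕ) (k : ℤ) : ℚ :=
  intChoose m k * intChoose (v + m) (m - k) -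
    intChoose m (k - 1) * intChoose (v + m) (m - k - 1)

theorem extensionCoeff_succ (m v : ℕ) (k : ℤ) :
    extensionCoeff (m + 1) v k =
      extensionCoeff m (v + 1) (k - 1) + ∑ j ∈ Finset.range (v + 1), extensionCoeff m j k := by
  have e1 : ((m + 1 : ℕ) : ℤ) - k = m - k + 1 := by push_cast; ring
  have e2 : (m : ℤ) - (k - 1) = m - k + 1 := by ring
  have e3 : (m : ℤ) - k + 1 - 1 = m - k := by ring
  have e4 : k - 1 - 1 = k - 2 := by ring
  induction v with
  | zero =>
    have s1 : intChoose m (m - k) = intChoose m k := intChoose_symm m k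
    have s2 : intChoose m (m - k + 1) = intChoose m (k - 1) := by rw [← e2, intChoose_symm]
    have s3 : intChoose m (m - k - 1) = intChoose m (k + 1) := by
      rw [← intChoose_symm, show (m : ℤ) - (m - k - 1) = k + 1 by ring]
    simp only [extensionCoeff, Finset.sum_range_one, zero_add, e1, e2, e3, e4,
      show 1 + m = m + 1 by ring, intChoose_succ, s1, s2, s3]
    ring
  | succ v ih =>
    have key : extensionCoeff (m + 1) (v + 1) k - extensionCoeff (m + 1) v k =
        extensionCoeff m (v + 2) (k - 1) - extensionCoeff m (v + 1) (k - 1) +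
          extensionCoeff m (v + 1) k := by
      simp only [extensionCoeff, e1, e2, e3, e4, show v + 1 + (m + 1) = v + m + 1 + 1 by ring,
        show v + (m + 1) = v + m + 1 by ring, show v + 2 + m = v + m + 1 + 1 by ring,
        show v + 1 + m = v + m + 1 by ring]
      generalize v + m + 1 = N
      simp only [intChoose_succ, e3, e4]
      ring
    rw [Finset.sum_range_succ]
    linear_combination key + ih

theorem coeff_extensionPoly (m v k : ℕ) :
    (extensionPoly m (v + 1)).coeff k = extensionCoeff m v k := by
  induction m generalizing v k with
  | zero =>
    rcases k with _ | k
    · simp [extensionPoly, extensionCoeff, intChoose]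
    · have h : (0 : ℤ) - (k + 1 : ℕ) < 0 := by omega
      rw [extensionCoeff, Nat.cast_zero, intChoose_of_neg _ h,
        intChoose_of_neg (v + 0) (b := 0 - (k + 1 : ℕ) - 1) (by omega)]
      simp [extensionPoly, Polynomial.coeff_one]
  | succ m ih =>
    rw [extensionPoly, extensionCoeff_succ, Polynomial.coeff_add, Polynomial.finsetSum_coeff,
      Finset.sum_congr rfl fun j _ => ih j k]
    congr 1
    rcases k with _ | k
    · simp [extensionCoeff, intChoose_of_neg]
    · rw [Polynomial.coeff_X_mul, ih]
      simp

theorem narayana_eq_extensionCoeff (m j : ℕ) :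
    (1 / (m + 1 : ℕ) : ℚ) * (m + 1).choose (j + 1) * (m + 1).choose j =
      extensionCoeff m 0 j := by
  rw [extensionCoeff, zero_add, intChoose_symm, sub_sub, intChoose_symm,
    show (j : ℤ) + 1 = (j + 1 : ℕ) by simp, intChoose_natCast, intChoose_natCast]
  have h1 : ((m + 1 : ℕ) : ℚ) * m.choose j = (m + 1).choose (j + 1) * (j + 1 : ℕ) := by
    exact_mod_cast Nat.add_one_mul_choose_eq m j
  have h2 : ((m + 1).choose j : ℚ) = m.choose j + intChoose m (j - 1) := by
    rw [← intChoose_natCast, intChoose_succ, intChoose_natCast]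
  have h3 : ((m + 1).choose (j + 1) : ℚ) = m.choose (j + 1) + m.choose j := by
    rw [Nat.choose_succ_succ]
    push_cast
    ring
  have h4 : (j : ℚ) * m.choose j = (m - j + 1) * intChoose m (j - 1) := by
    rcases j with _ | i
    · simp [intChoose_of_neg]
    · rw [show ((i + 1 : ℕ) : ℤ) - 1 = i by simp, intChoose_natCast]
      rcases le_or_gt i m with him | him
      · have h : (m.choose (i + 1) : ℚ) * (i + 1) = m.choose i * (m - i) := by
          rw [← Nat.cast_sub him]
          exact_mod_cast Nat.choose_succ_right_eq m i
        push_cast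
        linear_combination h
      · simp [Nat.choose_eq_zero_of_lt him, Nat.choose_eq_zero_of_lt (him.trans i.lt_succ_self)]
  have hj : ((j : ℚ) + 1) ≠ 0 := by positivity
  have hm : ((m : ℚ) + 1) ≠ 0 := by positivity
  rw [h2]
  rw [h3] at h1 ⊢
  push_cast at h1 ⊢
  rw [one_div, mul_assoc, inv_mul_eq_iff_eq_mul₀ hm]
  refine mul_left_cancel₀ hj ?_
  set a : ℚ := (m.choose j : ℚ)
  set b := intChoose m (j - 1)
  linear_combination (-(a + b) - (m + 1) * b) * h1 - (m + 1) * a * h4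

/-- For `n ≥ 1`, the generating polynomial of noncrossing partitions of
`{1,…,n}` by number of blocks is the `n`-th Narayana polynomial
`∑_{k=1}^n (1/n) C(n,k) C(n,k-1) t^k`. -/
theorem stmt6 (n : ℕ) (hn : 1 ≤ n) :
    partPolyQ (Finset.Icc 1 n) (fun P => ¬ HasKCrossing P 2) =
      ∑ k ∈ Finset.Icc 1 n, C ((1 / n : ℚ) * n.choose k * n.choose (k - 1)) * X ^ k := by
  obtain ⟨m, rfl⟩ : ∃ m, n = m + 1 := ⟨n - 1, by omega⟩
  have hpoly : partPolyQ (Finset.Icc 1 (m + 1)) (fun P => ¬ HasKCrossing P 2) =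
      extensionPoly (m + 1) 0 := by
    rw [← add_zero (m + 1), ← sum_noncrossing_Icc]
    refine Finset.sum_congr rfl fun P _ => ?_
    rw [extensionPoly, mul_one]
    by_cases h : IsNoncrossing P
    · rw [if_pos h, if_pos ((not_hasKCrossing_two_iff_s6 P).2 h)]
    · rw [if_neg h, if_neg fun h' => h ((not_hasKCrossing_two_iff_s6 P).1 h')]
  rw [hpoly]
  ext k
  simp only [Finset.range_zero, Finset.sum_empty, Polynomial.finsetSum_coeff, add_zero,
    Polynomial.coeff_C_mul_X_pow, Finset.sum_ite_eq, extensionPoly, Finset.mem_Icc]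
  rcases k with _ | j
  · simp
  · rw [zero_add, Polynomial.coeff_X_mul, ← zero_add 1, coeff_extensionPoly,
      ← narayana_eq_extensionCoeff]
    split_ifs with hj
    · simp
    · simp [Nat.choose_eq_zero_of_lt (show m + 1 < j + 1 by omega)]
end

section
/- For all integers n ≥ 0 and k ≥ 2, the cardinality of the set 𝒞_n^{(k)} equals Σ_{i=0}^{n} C(n,i) · |ℰ_i^{(k)}|, where |ℰ_0^{(k)}| = 1; equivalently, there is a bijection between 𝒞_n^{(k)} and the disjoint union over i = 0,…,n of the cartesian products Com_{i+1}(n+1) × ℰ_i^{(k)}, where Com_{j}(m) is the set of sequences of j positive integers summing to m. -/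
/-- The triangular shape `△_n`: cells `(r,c)` with `1 ≤ c ≤ r ≤ n`. -/
def triangle (n : ℕ) : Finset (ℕ × ℕ) :=
  (Finset.Icc 1 n ×ˢ Finset.Icc 1 n).filter (fun p => p.2 ≤ p.1)

/-- At most one `1` in each row and at most one `1` in each column. -/
def RowColAtMostOne (F : Finset (ℕ × ℕ)) : Prop :=
  (∀ p ∈ F, ∀ q ∈ F, p.1 = q.1 → p = q) ∧ ∀ p ∈ F, ∀ q ∈ F, p.2 = q.2 → p = q

/-- `F` has a proper SE-chain of length `k`: cells `(r₁,c₁),…,(r_k,c_k)` in `F`,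
`r₁<⋯<r_k`, `c₁<⋯<c_k`, `c_k ≤ r₁`. -/
def HasProperSEChain (F : Finset (ℕ × ℕ)) (k : ℕ) : Prop :=
  ∃ f : Fin k → ℕ × ℕ, (∀ m, f m ∈ F) ∧ StrictMono (fun m => (f m).1) ∧
    StrictMono (fun m => (f m).2) ∧ ∀ a b : Fin k, (f b).2 ≤ (f a).1

/-- Membership in `𝒞_n^{(k)}`. -/
def MemC (n k : ℕ) (F : Finset (ℕ × ℕ)) : Prop :=
  F ⊆ triangle n ∧ RowColAtMostOne F ∧ ¬ HasProperSEChain F k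

/-- Membership in `ℰ_n^{(k)}`. -/
def MemE (n k : ℕ) (F : Finset (ℕ × ℕ)) : Prop :=
  MemC n k F ∧ ∀ i ∈ Finset.Icc 1 n, ∃ p ∈ F, p.1 = i ∨ p.2 = i

/-- The indices whose row or column contains a cell of `F`. -/
def support (F : Finset (ℕ × ℕ)) : Finset ℕ :=
  F.image Prod.fst ∪ F.image Prod.snd

theorem mem_support {F : Finset (ℕ × ℕ)} {i : ℕ} :
    i ∈ support F ↔ ∃ p ∈ F, p.1 = i ∨ p.2 = i := by
  simp only [support, Finset.mem_union, Finset.mem_image]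
  grind

theorem fst_mem_support {F : Finset (ℕ × ℕ)} {p : ℕ × ℕ} (hp : p ∈ F) : p.1 ∈ support F :=
  mem_support.2 ⟨p, hp, Or.inl rfl⟩

theorem snd_mem_support {F : Finset (ℕ × ℕ)} {p : ℕ × ℕ} (hp : p ∈ F) : p.2 ∈ support F :=
  mem_support.2 ⟨p, hp, Or.inr rfl⟩

/-- The conditions defining `𝒞_n^{(k)}`, apart from the bound `n` on the indices. -/
def Admissible (k : ℕ) (F : Finset (ℕ × ℕ)) : Prop :=
  (∀ p ∈ F, p.2 ≤ p.1) ∧ RowColAtMostOne F ∧ ¬ HasProperSEChain F k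

theorem memC_iff {n k : ℕ} {F : Finset (ℕ × ℕ)} :
    MemC n k F ↔ support F ⊆ Finset.Icc 1 n ∧ Admissible k F := by
  have h : F ⊆ triangle n ↔ support F ⊆ Finset.Icc 1 n ∧ ∀ p ∈ F, p.2 ≤ p.1 := by
    simp only [triangle, Finset.subset_iff, Finset.mem_filter, Finset.mem_product]
    refine ⟨fun h => ⟨fun i hi => ?_, fun p hp => (h hp).2⟩, fun h p hp =>
      ⟨⟨h.1 (fst_mem_support hp), h.1 (snd_mem_support hp)⟩, h.2 p hp⟩⟩
    obtain ⟨p, hp, rfl | rfl⟩ := mem_support.1 hi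
    exacts [(h hp).1.1, (h hp).1.2]
  rw [MemC, h, Admissible, and_assoc]

theorem memE_iff {n k : ℕ} {F : Finset (ℕ × ℕ)} :
    MemE n k F ↔ support F = Finset.Icc 1 n ∧ Admissible k F := by
  simp only [MemE, memC_iff, ← mem_support]
  rw [Finset.Subset.antisymm_iff, and_right_comm]
  rfl

/-- Reindexing both coordinates of every cell of `F` by `φ`. -/
def reindex (φ : ℕ → ℕ) (F : Finset (ℕ × ℕ)) : Finset (ℕ × ℕ) :=
  F.image (Prod.map φ φ)

theorem support_reindex (φ : ℕ → ℕ) (F : Finset (ℕ × ℕ)) :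
    support (reindex φ F) = (support F).image φ := by
  simp [support, reindex, Finset.image_union, Finset.image_image, Function.comp_def]

theorem Admissible.reindex {k : ℕ} {F : Finset (ℕ × ℕ)} (hF : Admissible k F) {φ : ℕ → ℕ}
    (hφ : StrictMonoOn φ (support F : Set ℕ)) : Admissible k (reindex φ F) := by
  obtain ⟨hle, ⟨hrow, hcol⟩, hchain⟩ := hF
  simp only [Admissible, RowColAtMostOne, _root_.reindex, Finset.forall_mem_image, Prod.map_fst,
    Prod.map_snd]
  refine ⟨fun p hp => (hφ.le_iff_le (snd_mem_support hp) (fst_mem_support hp)).2 (hle p hp),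
    ⟨fun p hp q hq h => ?_, fun p hp q hq h => ?_⟩, ?_⟩
  · rw [hrow p hp q hq (hφ.injOn (fst_mem_support hp) (fst_mem_support hq) h)]
  · rw [hcol p hp q hq (hφ.injOn (snd_mem_support hp) (snd_mem_support hq) h)]
  · rintro ⟨f, hf, hr, hc, hproper⟩
    simp only [Finset.mem_image] at hf
    choose g hg hgf using hf
    obtain rfl : (fun m => Prod.map φ φ (g m)) = f := funext hgf
    exact hchain ⟨g, hg,
      fun a b hab => (hφ.lt_iff_lt (fst_mem_support (hg a)) (fst_mem_support (hg b))).1 (hr hab),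
      fun a b hab => (hφ.lt_iff_lt (snd_mem_support (hg a)) (snd_mem_support (hg b))).1 (hc hab),
      fun a b => (hφ.le_iff_le (snd_mem_support (hg b)) (fst_mem_support (hg a))).1 (hproper a b)⟩

theorem reindex_subset_of_reindex_eq {S : Finset ℕ} {φ : ℕ → ℕ} (hφ : Set.InjOn φ (S : Set ℕ))
    {F G : Finset (ℕ × ℕ)} (hF : support F ⊆ S) (hG : support G ⊆ S)
    (h : reindex φ F = reindex φ G) : F ⊆ G := by
  intro p hp
  have hmem : Prod.map φ φ p ∈ reindex φ G := h ▸ Finset.mem_image_of_mem _ hp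
  obtain ⟨q, hq, hqp⟩ := Finset.mem_image.1 hmem
  obtain ⟨h₁, h₂⟩ := Prod.ext_iff.1 hqp
  have : q = p := Prod.ext
    (hφ (hG (fst_mem_support hq)) (hF (fst_mem_support hp)) h₁)
    (hφ (hG (snd_mem_support hq)) (hF (snd_mem_support hp)) h₂)
  exact this ▸ hq

theorem subset_product_support (F : Finset (ℕ × ℕ)) : F ⊆ support F ×ˢ support F :=
  fun _ hp => Finset.mem_product.2 ⟨fst_mem_support hp, snd_mem_support hp⟩

open Classical in
/-- The admissible fillings whose support is exactly `S`. -/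
noncomputable def fillingsOn (k : ℕ) (S : Finset ℕ) : Finset (Finset (ℕ × ℕ)) :=
  (S ×ˢ S).powerset.filter fun F => support F = S ∧ Admissible k F

theorem mem_fillingsOn {k : ℕ} {S : Finset ℕ} {F : Finset (ℕ × ℕ)} :
    F ∈ fillingsOn k S ↔ support F = S ∧ Admissible k F := by
  simp only [fillingsOn, Finset.mem_filter, Finset.mem_powerset, and_iff_right_iff_imp]
  rintro ⟨rfl, -⟩
  exact subset_product_support F

theorem card_fillingsOn_le (k : ℕ) {S : Finset ℕ} {φ : ℕ → ℕ}
    (hφ : StrictMonoOn φ (S : Set ℕ)) :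
    (fillingsOn k S).card ≤ (fillingsOn k (S.image φ)).card := by
  refine Finset.card_le_card_of_injOn (reindex φ) (fun F hF => ?_) fun F hF G hG h => ?_
  · obtain ⟨rfl, hadm⟩ := mem_fillingsOn.1 hF
    exact mem_fillingsOn.2 ⟨support_reindex φ F, hadm.reindex hφ⟩
  · have hF := (mem_fillingsOn.1 hF).1.subset
    have hG := (mem_fillingsOn.1 hG).1.subset
    exact (reindex_subset_of_reindex_eq hφ.injOn hF hG h).antisymm
      (reindex_subset_of_reindex_eq hφ.injOn hG hF h.symm)

theorem exists_strictMonoOn_image_eq {S T : Finset ℕ} (h : S.card = T.card) :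
    ∃ φ : ℕ → ℕ, StrictMonoOn φ (S : Set ℕ) ∧ S.image φ = T := by
  let e : S ≃o T := (S.orderIsoOfFin h).symm.trans (T.orderIsoOfFin rfl)
  let φ : ℕ → ℕ := fun x => if hx : x ∈ S then (e ⟨x, hx⟩ : ℕ) else 0
  have he : ∀ x (hx : x ∈ S), φ x = e ⟨x, hx⟩ := fun x hx => dif_pos hx
  refine ⟨φ, fun x hx y hy hxy => ?_, ?_⟩
  · rw [he x hx, he y hy]
    exact e.strictMono hxy
  · ext y
    rw [Finset.mem_image]
    constructor
    · rintro ⟨x, hx, rfl⟩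
      rw [he x hx]
      exact (e ⟨x, hx⟩).2
    · intro hy
      refine ⟨e.symm ⟨y, hy⟩, (e.symm ⟨y, hy⟩).2, ?_⟩
      rw [he _ (e.symm ⟨y, hy⟩).2]
      simp

theorem card_fillingsOn_eq (k : ℕ) {S T : Finset ℕ} (h : S.card = T.card) :
    (fillingsOn k S).card = (fillingsOn k T).card := by
  obtain ⟨φ, hφ, hφT⟩ := exists_strictMonoOn_image_eq h
  obtain ⟨ψ, hψ, hψS⟩ := exists_strictMonoOn_image_eq h.symm
  exact (hφT ▸ card_fillingsOn_le k hφ).antisymm (hψS ▸ card_fillingsOn_le k hψ)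

theorem card_memE (n k : ℕ) :
    Nat.card {F : Finset (ℕ × ℕ) // MemE n k F} = (fillingsOn k (Finset.Icc 1 n)).card :=
  Nat.subtype_card _ fun _ => mem_fillingsOn.trans memE_iff.symm

theorem card_memC (n k : ℕ) :
    Nat.card {F : Finset (ℕ × ℕ) // MemC n k F} =
      ∑ S ∈ (Finset.Icc 1 n).powerset, (fillingsOn k S).card := by
  classical
  rw [← Finset.card_biUnion]
  · refine Nat.subtype_card _ fun F => ?_
    simp [mem_fillingsOn, memC_iff]
  · refine fun S _ T _ hST => Finset.disjoint_left.2 fun F hS hT => hST ?_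
    rw [← (mem_fillingsOn.1 hS).1, (mem_fillingsOn.1 hT).1]

/-- For `n ≥ 0`, `k ≥ 2`:
`|𝒞_n^{(k)}| = ∑_{i=0}^n C(n,i) ⬝ |ℰ_i^{(k)}|` (with `|ℰ_0^{(k)}| = 1`). -/
theorem stmt9 (n k : ℕ) (hk : 2 ≤ k) :
    Nat.card {F : Finset (ℕ × ℕ) // MemC n k F} =
      ∑ i ∈ Finset.range (n + 1),
        n.choose i * Nat.card {F : Finset (ℕ × ℕ) // MemE i k F} := by
  rw [card_memC, Finset.sum_congr rfl fun S _ =>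
    card_fillingsOn_eq k (T := Finset.Icc 1 S.card) (by simp)]
  rw [Finset.sum_powerset_apply_card fun i => (fillingsOn k (Finset.Icc 1 i)).card]
  simp [card_memE]
end
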